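/- arXiv:1403.2880 — 2 statements merged into one kernel-verified Lean document; each statement's English description precedes it below -/
import Mathlib

section
/- Let q be a power of two. If f ∈ F_q[x] is an exceptional o-polynomial of F_q, then f is equivalent to either x^6 or x^{2^k} for some positive integer k. -/
open Polynomial

/-- An o-polynomial of a finite field `F`: a polynomial of degree at most `|F| - 1`
inducing a permutation of `F` with `f(0) = 0`, `f(1) = 1`, such that no three points
of the graph of `f` are collinear. -/
def IsOPoly (F : Type*) [Field F] [Finite F] (f : F[X]) : Prop :=
  f.natDegree ≤ Nat.card F - 1 ∧
  Function.Bijective (fun x : F => f.eval x) ∧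
  f.eval 0 = 0 ∧ f.eval 1 = 1 ∧
  ∀ a b c : F, a ≠ b → a ≠ c → b ≠ c →
    Matrix.det !![1, 1, 1; a, b, c; f.eval a, f.eval b, f.eval c] ≠ 0

/-- Two polynomials `f`, `g` are equivalent if
`g(x) = (f(x+a) + f(a)) / (f(1+a) + f(a))` for some `a ∈ F`. -/
def OEquiv (F : Type*) [Field F] (f g : F[X]) : Prop :=
  ∃ a : F, g = Polynomial.C (f.eval (1 + a) + f.eval a)⁻¹ *
    (f.comp (Polynomial.X + Polynomial.C a) + Polynomial.C (f.eval a))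

/-- `f ∈ F_q[x]` (with `q = 2^h`) is an exceptional o-polynomial if it is an
o-polynomial of `F_{q^r}` (realised as the Galois field with `2^(h*r)` elements,
via some field embedding) for infinitely many positive integers `r`. -/
def IsExceptionalOPoly (F : Type*) [Field F] [Finite F] (h : ℕ) (f : F[X]) : Prop :=
  {r : ℕ | 0 < r ∧ ∃ ι : F →+* GaloisField 2 (h * r),
    IsOPoly (GaloisField 2 (h * r)) (f.map ι)}.Infinite

namespace OPolyAux

lemma psum {K : Type*} [Field K] [Fintype K] {m : ℕ} (hc : Fintype.card K = 2 ^ m) {E : ℕ}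
    (hE : 0 < E) : ∑ x : K, x ^ E = if 2 ^ m - 1 ∣ E then -1 else 0 := by
  classical
  rw [← hc, ← FiniteField.sum_pow_units K E]
  rw [← Finset.sum_subset (Finset.subset_univ (Finset.univ.filter (fun x : K => x ≠ 0)))]
  · symm
    refine Finset.sum_bij (fun u _ => (u : K)) ?_ ?_ ?_ ?_
    · simp
    · intro a _ b _ h; exact Units.ext h
    · intro b hb
      simp only [Finset.mem_filter] at hb
      exact ⟨Units.mk0 b hb.2, Finset.mem_univ _, rfl⟩
    · intro a _; simp
  · intro x _ hx
    simp only [Finset.mem_filter, Finset.mem_univ, true_and, not_not] at hx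
    rw [hx, zero_pow hE.ne']

lemma slope_inj {K : Type*} [Field K] [Fintype K] [CharP K 2] {f : K[X]} (hf : IsOPoly K f)
    (x : K) : Function.Injective (fun d : K => (f.eval (x + d) + f.eval x) / d) := by
  obtain ⟨-, hb, -, -, hd⟩ := hf
  have key : ∀ d : K, (f.eval (x + d) + f.eval x) / d = 0 → d = 0 := by
    intro d h
    rcases div_eq_zero_iff.mp h with h | h
    · rw [CharTwo.add_eq_zero] at h
      have := hb.1 h
      simpa using this
    · exact h
  intro d e h
  simp only at h
  by_cases hd0 : d = 0
  · subst hd0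
    simp only [div_zero] at h
    exact (key e h.symm).symm
  by_cases he0 : e = 0
  · subst he0
    simp only [div_zero] at h
    exact key d h
  by_contra hne
  refine hd x (x + d) (x + e) (by simpa using hd0) (by simpa using he0) (by simpa using hne) ?_
  rw [div_eq_div_iff hd0 he0] at h
  rw [Matrix.det_fin_three]
  simp only [Matrix.of_apply, Matrix.cons_val', Matrix.cons_val_zero, Matrix.cons_val_one,
    Matrix.cons_val, Matrix.cons_val_fin_one]
  have h2 : (2 : K) = 0 := CharTwo.two_eq_zero
  linear_combination (-1 : K) * h + (e * f.eval x - d * f.eval x) * h2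

lemma even_hits {K : Type*} [Field K] [Fintype K] [CharP K 2] {f : K[X]} (hf : IsOPoly K f)
    {s : K} (hs : s ≠ 0) (g : K → K) : ∑ x : K, g (s * x + f.eval x) = 0 := by
  have hex : ∀ x : K, ∃ d : K, (f.eval (x + d) + f.eval x) / d = s := fun x =>
    Finite.surjective_of_injective (slope_inj hf x) s
  choose d hd using hex
  have hd0 : ∀ x, d x ≠ 0 := by
    intro x h
    have := hd x
    rw [h, div_zero] at this
    exact hs this.symm
  have hdd : ∀ x, d (x + d x) = d x := by
    intro x
    apply slope_inj hf (x + d x)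
    simp only
    rw [hd (x + d x), add_assoc, CharTwo.add_self_eq_zero, add_zero, add_comm, hd x]
  refine Finset.sum_involution (fun x _ => x + d x) ?_ ?_ ?_ ?_
  · intro x _
    have h1 : f.eval (x + d x) + f.eval x = s * d x := by
      have := hd x
      rwa [div_eq_iff (hd0 x)] at this
    have h2 : s * (x + d x) + f.eval (x + d x) = s * x + f.eval x := by
      have : f.eval (x + d x) = s * d x + f.eval x := by
        rw [← h1, add_assoc, CharTwo.add_self_eq_zero, add_zero]
      rw [this]
      have h2 : (2 : K) = 0 := CharTwo.two_eq_zero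
      linear_combination (s * d x) * h2
    rw [h2, CharTwo.add_self_eq_zero]
  · intro x _ _ h
    exact hd0 x (by simpa using h)
  · simp
  · intro x _
    rw [hdd, add_assoc, CharTwo.add_self_eq_zero, add_zero]

lemma sum_two_pow_range (m : ℕ) : ∑ i ∈ Finset.range m, 2 ^ i = 2 ^ m - 1 := by
  have := Nat.geomSum_eq (le_refl 2) m
  simpa using this

lemma sum_two_pow_lt {m : ℕ} {A : Finset ℕ} (hA : A ⊆ Finset.range m) (hne : A ≠ Finset.range m) :
    ∑ i ∈ A, 2 ^ i < 2 ^ m - 1 := by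
  rw [← sum_two_pow_range]
  have hss := Finset.ssubset_iff_subset_ne.mpr ⟨hA, hne⟩
  obtain ⟨i, hi, hi'⟩ := Finset.exists_of_ssubset hss
  exact Finset.sum_lt_sum_of_subset hA hi hi' (by positivity) (by intros; positivity)

lemma prod_frob {K : Type*} [Field K] [CharP K 2] (U : Finset ℕ) (a b : K) :
    (a + b) ^ (∑ i ∈ U, 2 ^ i) =
      ∑ T ∈ U.powerset, a ^ (∑ i ∈ T, 2 ^ i) * b ^ (∑ i ∈ U \ T, 2 ^ i) := by
  rw [← Finset.prod_pow_eq_pow_sum]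
  simp_rw [add_pow_char_pow, Finset.prod_add, Finset.prod_pow_eq_pow_sum]

lemma glynn {K : Type*} [Field K] [Fintype K] [CharP K 2] {m : ℕ} (hc : Fintype.card K = 2 ^ m)
    {f : K[X]} (hf : IsOPoly K f) {A L : Finset ℕ} (hA : A ⊆ Finset.range m)
    (hL : L ⊆ Finset.range m) (hdis : Disjoint A L) (hAn : A.Nonempty)
    (hne : A ≠ Finset.range m) :
    ∑ x : K, f.eval x ^ (∑ i ∈ A, 2 ^ i) * x ^ (∑ i ∈ L, 2 ^ i) = 0 := by
  classical
  set l := ∑ i ∈ L, 2 ^ i with hl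
  have hU : A ∪ L ⊆ Finset.range m := Finset.union_subset hA hL
  have hLne : L ≠ Finset.range m := by
    rintro rfl
    obtain ⟨a, ha⟩ := hAn
    exact (Finset.disjoint_left.mp hdis ha) (hA ha)
  have hlt : l < 2 ^ m - 1 := sum_two_pow_lt hL hLne
  have h0 : ∑ s : K, s ^ (2 ^ m - 1 - l) *
      ∑ x : K, (s * x + f.eval x) ^ (∑ i ∈ A ∪ L, 2 ^ i) = 0 := by
    apply Finset.sum_eq_zero
    intro s _
    by_cases hs : s = 0
    · rw [hs, zero_pow (by omega), zero_mul]
    · rw [even_hits hf hs (fun y => y ^ (∑ i ∈ A ∪ L, 2 ^ i)), mul_zero]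
  have hsd : (A ∪ L) \ L = A := by
    rw [Finset.union_sdiff_right, Finset.sdiff_eq_self_iff_disjoint]
    exact hdis
  have hkey : ∀ T ∈ (A ∪ L).powerset, ∀ x : K,
      ∑ s : K, s ^ (2 ^ m - 1 - l) * ((s * x) ^ (∑ i ∈ T, 2 ^ i) *
        f.eval x ^ (∑ i ∈ (A ∪ L) \ T, 2 ^ i)) =
      if T = L then - (f.eval x ^ (∑ i ∈ A, 2 ^ i) * x ^ l) else 0 := by
    intro T hT x
    have hT' := Finset.mem_powerset.mp hT
    have e1 : ∀ s : K, s ^ (2 ^ m - 1 - l) * ((s * x) ^ (∑ i ∈ T, 2 ^ i) *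
        f.eval x ^ (∑ i ∈ (A ∪ L) \ T, 2 ^ i)) =
        s ^ (2 ^ m - 1 - l + ∑ i ∈ T, 2 ^ i) * (x ^ (∑ i ∈ T, 2 ^ i) *
        f.eval x ^ (∑ i ∈ (A ∪ L) \ T, 2 ^ i)) := by
      intro s
      rw [mul_pow, pow_add]; ring
    simp_rw [e1]
    rw [← Finset.sum_mul, psum hc (by omega)]
    by_cases hTL : T = L
    · subst hTL
      rw [if_pos rfl, if_pos (by rw [← hl, Nat.sub_add_cancel hlt.le]), hsd]
      ring
    · rw [if_neg hTL, if_neg, zero_mul]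
      intro hdiv
      have hTle : ∑ i ∈ T, 2 ^ i ≤ 2 ^ m - 1 := by
        rw [← sum_two_pow_range]
        exact Finset.sum_le_sum_of_subset (hT'.trans hU)
      obtain ⟨q, hq⟩ := hdiv
      have hq1 : q = 1 ∨ q = 2 ∨ 3 ≤ q := by
        rcases q with _ | _ | _ | q
        · simp at hq; omega
        · left; rfl
        · right; left; rfl
        · right; right; omega
      rcases hq1 with rfl | rfl | h3
      · apply hTL
        apply Finset.geomSum_injective (le_refl 2)
        simp only
        omega
      · -- then T = range m, L empty
        have hl0 : l = 0 := by omega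
        have hT2 : T = Finset.range m := by
          by_contra hTr
          have := sum_two_pow_lt (hT'.trans hU) hTr
          omega
        have hLe : L = ∅ := by
          by_contra hLe
          obtain ⟨a, ha⟩ := Finset.nonempty_iff_ne_empty.mpr hLe
          have := (Finset.sum_eq_zero_iff.mp (hl.symm.trans hl0)) a ha
          exact absurd this (by positivity)
        apply hne
        apply Finset.Subset.antisymm hA
        rw [← hT2]
        simpa [hLe] using hT'
      · have : (2 ^ m - 1) * 3 ≤ (2 ^ m - 1) * q := Nat.mul_le_mul_left _ h3
        omega
  simp_rw [prod_frob, Finset.mul_sum] at h0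
  rw [Finset.sum_comm] at h0
  simp_rw [Finset.sum_comm (s := Finset.univ) (t := (A ∪ L).powerset)] at h0
  rw [Finset.sum_comm] at h0
  rw [Finset.sum_comm] at h0
  rw [Finset.sum_congr rfl (fun T hT => Finset.sum_congr rfl (fun x _ => hkey T hT x))] at h0
  have hLm : L ∈ (A ∪ L).powerset := Finset.mem_powerset.mpr Finset.subset_union_right
  rw [Finset.sum_eq_single_of_mem L hLm] at h0
  · simp only [if_true, Finset.sum_neg_distrib, neg_eq_zero] at h0
    exact h0
  · intro T _ hT
    simp [hT]

lemma glynn_coeff {K : Type*} [Field K] [Fintype K] [CharP K 2] {m : ℕ}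
    (hc : Fintype.card K = 2 ^ m)
    {f : K[X]} (hf : IsOPoly K f) {A L : Finset ℕ} (hA : A ⊆ Finset.range m)
    (hL : L ⊆ Finset.range m) (hdis : Disjoint A L) (hAn : A.Nonempty)
    (hne : A ≠ Finset.range m)
    {T : Finset ℕ} (hT : f.support ⊆ T) (h00 : 0 ∉ T) :
    ∑ e ∈ Fintype.piFinset (fun _ : A => T),
      (if 2 ^ m - 1 ∣ ∑ a : A, 2 ^ (a : ℕ) * e a + ∑ i ∈ L, 2 ^ i then
        ∏ a : A, f.coeff (e a) ^ (2 ^ (a : ℕ)) else 0) = 0 := by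
  classical
  have h := glynn hc hf hA hL hdis hAn hne
  have e1 : ∀ x : K, f.eval x ^ (∑ i ∈ A, 2 ^ i) * x ^ (∑ i ∈ L, 2 ^ i) =
      ∑ e ∈ Fintype.piFinset (fun _ : A => T),
        (∏ a : A, f.coeff (e a) ^ (2 ^ (a : ℕ))) *
          x ^ (∑ a : A, 2 ^ (a : ℕ) * e a + ∑ i ∈ L, 2 ^ i) := by
    intro x
    rw [← Finset.prod_pow_eq_pow_sum, ← Finset.prod_coe_sort]
    have e2 : ∀ a : A, f.eval x ^ (2 ^ (a : ℕ)) =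
        ∑ e ∈ T, f.coeff e ^ (2 ^ (a : ℕ)) * x ^ (2 ^ (a : ℕ) * e) := by
      intro a
      rw [Polynomial.eval_eq_sum, Polynomial.sum, Finset.sum_subset hT (by
        intro i _ hi
        rw [Polynomial.notMem_support_iff.mp hi, zero_mul]), sum_pow_char_pow]
      refine Finset.sum_congr rfl fun e _ => ?_
      rw [mul_pow, ← pow_mul, mul_comm e]
    simp_rw [e2]
    rw [Finset.prod_univ_sum, Finset.sum_mul]
    refine Finset.sum_congr rfl fun e _ => ?_
    rw [Finset.prod_mul_distrib, pow_add, Finset.prod_pow_eq_pow_sum, mul_assoc]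
  simp_rw [e1] at h
  rw [Finset.sum_comm] at h
  rw [← neg_eq_zero]
  refine Eq.trans ?_ h
  rw [← Finset.sum_neg_distrib]
  refine Finset.sum_congr rfl fun e he => ?_
  rw [← Finset.mul_sum, psum hc]
  · split_ifs <;> simp
  · obtain ⟨a, ha⟩ := hAn
    have h1 : 0 < e ⟨a, ha⟩ := by
      rcases Nat.eq_zero_or_pos (e ⟨a, ha⟩) with h | h
      · exact absurd (h ▸ Fintype.mem_piFinset.mp he ⟨a, ha⟩) h00
      · exact h
    have h2 : 2 ^ ((⟨a, ha⟩ : A) : ℕ) * e ⟨a, ha⟩ ≤ ∑ a : A, 2 ^ (a : ℕ) * e a :=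
      Finset.single_le_sum (f := fun a : A => 2 ^ (a : ℕ) * e a) (fun _ _ => Nat.zero_le _)
        (Finset.mem_univ _)
    have h3 : 0 < 2 ^ ((⟨a, ha⟩ : A) : ℕ) * e ⟨a, ha⟩ := by positivity
    omega

lemma key_unique {K : Type*} [Field K] [Fintype K] [CharP K 2] {m : ℕ}
    (hc : Fintype.card K = 2 ^ m)
    {f : K[X]} (hf : IsOPoly K f) {A L : Finset ℕ} (hA : A ⊆ Finset.range m)
    (hL : L ⊆ Finset.range m) (hdis : Disjoint A L) (hAn : A.Nonempty)
    (hne : A ≠ Finset.range m) (e : ℕ → ℕ) (he : ∀ a ∈ A, e a ∈ f.support)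
    (hdiv : 2 ^ m - 1 ∣ ∑ a ∈ A, 2 ^ a * e a + ∑ i ∈ L, 2 ^ i)
    (huniq : ∀ e' : ℕ → ℕ, (∀ a ∈ A, e' a ∈ f.support) →
      2 ^ m - 1 ∣ ∑ a ∈ A, 2 ^ a * e' a + ∑ i ∈ L, 2 ^ i → ∀ a ∈ A, e' a = e a) : False := by
  classical
  have h00 : 0 ∉ f.support := by
    have := hf.2.2.1
    rw [← Polynomial.coeff_zero_eq_eval_zero] at this
    simpa using this
  have h := glynn_coeff hc hf hA hL hdis hAn hne (Finset.Subset.refl f.support) h00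
  have hmem : (fun a : A => e a) ∈ Fintype.piFinset (fun _ : A => f.support) := by
    rw [Fintype.mem_piFinset]
    intro a; exact he a a.2
  rw [Finset.sum_eq_single_of_mem _ hmem] at h
  · have h1 : ∑ a : A, 2 ^ (a : ℕ) * e a = ∑ a ∈ A, 2 ^ a * e a :=
      Finset.sum_coe_sort A (fun a => 2 ^ a * e a)
    rw [h1, if_pos hdiv, Finset.prod_eq_zero_iff] at h
    obtain ⟨a, -, ha⟩ := h
    have := he a a.2
    rw [Polynomial.mem_support_iff] at this
    exact this (eq_zero_of_pow_eq_zero ha)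
  · intro e' he' hne'
    rw [if_neg]
    intro hd
    apply hne'
    let e'' : ℕ → ℕ := fun a => if h : a ∈ A then e' ⟨a, h⟩ else 0
    have he'' : ∀ a : A, e'' a = e' a := by
      intro a
      simp [e'']
    have h2 : ∑ a : A, 2 ^ (a : ℕ) * e' a = ∑ a ∈ A, 2 ^ a * e'' a := by
      rw [← Finset.sum_coe_sort A (fun a => 2 ^ a * e'' a)]
      exact Finset.sum_congr rfl fun a _ => by rw [he'']
    rw [h2] at hd
    have := huniq e'' (by
      intro a ha
      rw [show e'' a = e' ⟨a, ha⟩ from he'' ⟨a, ha⟩]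
      exact Fintype.mem_piFinset.mp he' ⟨a, ha⟩) hd
    funext a
    rw [← he'' a, this a a.2]

end OPolyAux

namespace OPolyAux

lemma sum_bits (l : ℕ) : ∑ i ∈ l.bitIndices.toFinset, 2 ^ i = l := by simp

lemma bits_subset {l m : ℕ} (h : l < 2 ^ m) : l.bitIndices.toFinset ⊆ Finset.range m := by
  intro i hi
  simp only [List.mem_toFinset, Nat.mem_bitIndices] at hi
  have := Nat.ge_two_pow_of_testBit hi
  rw [Finset.mem_range]
  exact (Nat.pow_lt_pow_iff_right (by norm_num : 1 < 2)).mp (lt_of_le_of_lt this h)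

/-- Only even exponents occur. -/
lemma support_even {K : Type*} [Field K] [Fintype K] [CharP K 2] {m : ℕ} (hm : 2 ≤ m)
    (hc : Fintype.card K = 2 ^ m)
    {f : K[X]} (hf : IsOPoly K f) (hdeg : f.natDegree < 2 ^ m - 1) {e : ℕ} (he : e ∈ f.support) :
    Even e := by
  by_contra ho
  rw [Nat.not_even_iff_odd] at ho
  have hle : ∀ e ∈ f.support, e < 2 ^ m - 1 := fun e he =>
    lt_of_le_of_lt (Polynomial.le_natDegree_of_mem_supp e he) hdeg
  have h4 : 4 ≤ 2 ^ m := by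
    calc 4 = 2 ^ 2 := by norm_num
      _ ≤ 2 ^ m := Nat.pow_le_pow_right (by norm_num) hm
  have hpe : Even (2 ^ m) := (Nat.even_pow.mpr ⟨by norm_num, by omega⟩)
  have h1 := hle e he
  set l := 2 ^ m - 1 - e with hl
  have hev : l % 2 = 0 := by
    obtain ⟨a, ha⟩ := hpe
    obtain ⟨b, hb⟩ := ho
    omega
  refine key_unique hc hf (A := {0}) (L := l.bitIndices.toFinset) ?_ (bits_subset (by omega)) ?_
    (by simp) ?_ (fun _ => e) ?_ ?_ ?_
  · simp; omega
  · simp [hev]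
  · intro h
    have : (1 : ℕ) ∈ ({0} : Finset ℕ) := by rw [h]; simp; omega
    simp at this
  · intro a _; exact he
  · rw [sum_bits]
    simp only [Finset.sum_singleton, pow_zero, one_mul]
    exact ⟨1, by omega⟩
  · intro e' he' hd a ha
    rw [sum_bits] at hd
    simp only [Finset.mem_singleton] at ha
    subst ha
    simp only [Finset.sum_singleton, pow_zero, one_mul] at hd
    have h2 := hle _ (he' 0 (by simp))
    have h0 : e' 0 ≠ 0 := by
      intro h0
      have h3 := he' 0 (by simp)
      rw [h0] at h3
      have := hf.2.2.1
      rw [← Polynomial.coeff_zero_eq_eval_zero] at this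
      rw [Polynomial.mem_support_iff] at h3
      exact h3 this
    obtain ⟨q, hq⟩ := hd
    rcases q with _ | _ | q
    · omega
    · omega
    · have : (2 ^ m - 1) * 2 ≤ (2 ^ m - 1) * (q + 1 + 1) := Nat.mul_le_mul_left _ (by omega)
      omega

def SS (n m : ℕ) : Prop := ∃ A L : Finset ℕ, A ⊆ Finset.range m ∧ L ⊆ Finset.range m ∧
  Disjoint A L ∧ 0 ∈ A ∧ n * ∑ i ∈ A, 2 ^ i + ∑ i ∈ L, 2 ^ i = 2 * (2 ^ m - 1)

lemma SS_false {K : Type*} [Field K] [Fintype K] [CharP K 2] {m : ℕ} (hm : 2 ≤ m)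
    (hc : Fintype.card K = 2 ^ m)
    {f : K[X]} (hf : IsOPoly K f) (hdeg : f.natDegree < 2 ^ m - 1) (h3 : 3 ≤ f.natDegree)
    (hS : SS f.natDegree m) : False := by
  obtain ⟨A, L, hA, hL, hdis, h0, hsum⟩ := hS
  set n := f.natDegree with hn
  have hf0 : f ≠ 0 := by
    rintro rfl
    simp at hn
    omega
  have hnm : n ∈ f.support := Polynomial.natDegree_mem_support_of_nonzero hf0
  have h4 : 4 ≤ 2 ^ m := by
    calc 4 = 2 ^ 2 := by norm_num
      _ ≤ 2 ^ m := Nat.pow_le_pow_right (by norm_num) hm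
  have hpe : Even (2 ^ m) := (Nat.even_pow.mpr ⟨by norm_num, by omega⟩)
  have hLev : Even (∑ i ∈ L, 2 ^ i) := by
    apply Finset.even_sum
    intro i hi
    refine Nat.even_pow.mpr ⟨by norm_num, ?_⟩
    rintro rfl
    exact Finset.disjoint_left.mp hdis h0 hi
  refine key_unique hc hf hA hL hdis ⟨0, h0⟩ ?_ (fun _ => n) ?_ ?_ ?_
  · rintro rfl
    rw [sum_two_pow_range] at hsum
    have : 3 * (2 ^ m - 1) ≤ n * (2 ^ m - 1) := Nat.mul_le_mul_right _ h3
    omega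
  · intro _ _; exact hnm
  · rw [← Finset.sum_mul, mul_comm _ n, hsum]
    exact Dvd.intro_left 2 rfl
  · intro e' he' hd
    have hle : ∀ a ∈ A, 2 ^ a * e' a ≤ 2 ^ a * n := fun a ha =>
      Nat.mul_le_mul_left _ (Polynomial.le_natDegree_of_mem_supp _ (he' a ha))
    have hle' := Finset.sum_le_sum hle
    rw [← Finset.sum_mul, mul_comm _ n] at hle'
    have hpos : 0 < ∑ a ∈ A, 2 ^ a * e' a := by
      have h1 : 2 ^ 0 * e' 0 ≤ ∑ a ∈ A, 2 ^ a * e' a :=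
        Finset.single_le_sum (f := fun a => 2 ^ a * e' a) (fun _ _ => Nat.zero_le _) h0
      have h2 : e' 0 ≠ 0 := by
        intro h
        have h3 := he' 0 h0
        rw [h] at h3
        have := hf.2.2.1
        rw [← Polynomial.coeff_zero_eq_eval_zero] at this
        rw [Polynomial.mem_support_iff] at h3
        exact h3 this
      omega
    have hev : Even (∑ a ∈ A, 2 ^ a * e' a) := by
      apply Finset.even_sum
      intro a ha
      exact (support_even hm hc hf hdeg (he' a ha)).mul_left _
    have heq : ∑ a ∈ A, 2 ^ a * e' a = n * ∑ i ∈ A, 2 ^ i := by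
      obtain ⟨q, hq⟩ := hd
      obtain ⟨x, hx⟩ := hpe
      obtain ⟨y, hy⟩ := hLev
      obtain ⟨z, hz⟩ := hev
      rcases q with _ | _ | q
      · omega
      · omega
      · have : (2 ^ m - 1) * 2 ≤ (2 ^ m - 1) * (q + 1 + 1) := Nat.mul_le_mul_left _ (by omega)
        omega
    have heq' : ∑ a ∈ A, 2 ^ a * e' a = ∑ a ∈ A, 2 ^ a * n := by
      rw [heq, ← Finset.sum_mul, mul_comm]
    intro a ha
    have := (Finset.sum_eq_sum_iff_of_le hle).mp heq' a ha
    exact Nat.eq_of_mul_eq_mul_left (by positivity) this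

lemma sum_shift (m : ℕ) (A : Finset ℕ) :
    ∑ i ∈ A.map (addLeftEmbedding m), 2 ^ i = 2 ^ m * ∑ i ∈ A, 2 ^ i := by
  rw [Finset.sum_map, Finset.mul_sum]
  exact Finset.sum_congr rfl fun i _ => by simp [pow_add]

lemma SS_add {n m m' : ℕ} (h : SS n m) (h' : SS n m') : SS n (m + m') := by
  obtain ⟨A, L, hA, hL, hd, h0, hs⟩ := h
  obtain ⟨A', L', hA', hL', hd', h0', hs'⟩ := h'
  have hdj : ∀ {X Y : Finset ℕ}, X ⊆ Finset.range m →
      Disjoint X (Y.map (addLeftEmbedding m)) := by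
    intro X Y hX
    rw [Finset.disjoint_left]
    intro a ha hb
    have := Finset.mem_range.mp (hX ha)
    rw [Finset.mem_map] at hb
    obtain ⟨c, -, hc⟩ := hb
    simp at hc
    omega
  have hsub : ∀ {X Y : Finset ℕ}, X ⊆ Finset.range m → Y ⊆ Finset.range m' →
      X ∪ Y.map (addLeftEmbedding m) ⊆ Finset.range (m + m') := by
    intro X Y hX hY a ha
    rw [Finset.mem_union, Finset.mem_map] at ha
    rw [Finset.mem_range]
    rcases ha with ha | ⟨c, hc, rfl⟩
    · have := Finset.mem_range.mp (hX ha)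
      omega
    · have := Finset.mem_range.mp (hY hc)
      simp; omega
  refine ⟨A ∪ A'.map (addLeftEmbedding m), L ∪ L'.map (addLeftEmbedding m), hsub hA hA',
    hsub hL hL', ?_, by simp [h0], ?_⟩
  · rw [Finset.disjoint_union_left, Finset.disjoint_union_right, Finset.disjoint_union_right]
    refine ⟨⟨hd, hdj hA⟩, (hdj hL).symm, ?_⟩
    rw [Finset.disjoint_map]
    exact hd'
  · rw [Finset.sum_union (hdj hA), Finset.sum_union (hdj hL), sum_shift, sum_shift]
    have h1 : 1 ≤ 2 ^ m := Nat.one_le_two_pow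
    have h2 : 1 ≤ 2 ^ m' := Nat.one_le_two_pow
    have h3 : 1 ≤ 2 ^ (m + m') := Nat.one_le_two_pow
    zify [h1, h2, h3] at hs hs' ⊢
    rw [pow_add]
    linear_combination hs + 2 ^ m * hs'

lemma SS_gen {n m : ℕ} (A : Finset ℕ) (hA : A ⊆ Finset.range m) (h0 : 0 ∈ A) (N : ℕ)
    (hN : N = n * ∑ i ∈ A, 2 ^ i + 1) (hlo : 2 ^ m ≤ N) (hhi : N < 2 ^ (m + 1))
    (hbit : ∀ i ∈ A, N.testBit i = true) : SS n m := by
  have hp : 2 ^ (m + 1) = 2 * 2 ^ m := by ring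
  refine ⟨A, (2 ^ (m + 1) - (N + 1)).bitIndices.toFinset, hA, bits_subset (by omega), ?_, h0, ?_⟩
  · rw [Finset.disjoint_left]
    intro i hi
    simp only [List.mem_toFinset, Nat.mem_bitIndices]
    rw [Nat.testBit_two_pow_sub_succ hhi, hbit i hi]
    simp
  · rw [sum_bits]; omega

lemma tb {N i : ℕ} (u v : ℕ) (hu : u < 2 ^ i) (h : N = u + 2 ^ i * (2 * v + 1)) :
    N.testBit i = true := by
  rw [Nat.testBit_eq_decide_div_mod_eq, h, Nat.add_mul_div_left _ _ (by positivity),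
    Nat.div_eq_of_lt hu]
  simp

lemma SS_coprime {n x y : ℕ} (hx : SS n x) (hy : SS n y) (hxy : Nat.gcd x y = 1) :
    ∃ m0, ∀ m ≥ m0, SS n m := by
  obtain ⟨N, hN⟩ := Nat.exists_mem_closure_of_ge ({x, y} : Set ℕ)
  refine ⟨N + 1, fun m hm => ?_⟩
  have hg : Nat.setGcd ({x, y} : Set ℕ) = 1 := by
    apply Nat.eq_one_of_dvd_one
    rw [← hxy]
    exact Nat.dvd_gcd (Nat.setGcd_dvd_of_mem (by simp)) (Nat.setGcd_dvd_of_mem (by simp))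
  have hmem := hN m (by omega) (by rw [hg]; exact one_dvd _)
  have : m = 0 ∨ SS n m := by
    clear hm
    induction hmem using AddSubmonoid.closure_induction with
    | mem z hz =>
      rcases hz with rfl | hz
      · exact Or.inr hx
      · rw [Set.mem_singleton_iff] at hz
        subst hz; exact Or.inr hy
    | zero => exact Or.inl rfl
    | add a b _ _ ha hb =>
      rcases ha with rfl | ha
      · simpa using hb
      · rcases hb with rfl | hb
        · exact Or.inr (by simpa using ha)
        · exact Or.inr (SS_add ha hb)
  rcases this with h | h
  · omega
  · exact h

lemma exists_top {w : ℕ} (hw : w ≠ 0) : ∃ p n0, w = 2 ^ p + n0 ∧ n0 < 2 ^ p := by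
  refine ⟨Nat.log 2 w, w - 2 ^ Nat.log 2 w, ?_, ?_⟩
  · have := Nat.pow_log_le_self 2 hw
    omega
  · have := Nat.lt_pow_succ_log_self (by norm_num : 1 < 2) w
    rw [Nat.succ_eq_add_one, pow_succ] at this
    omega

end OPolyAux

namespace OPolyAux

/-- generator with `k = 1` -/
lemma gen_one {n b w : ℕ} (hb : 1 ≤ b) (hn : n = 2 ^ b + w) (hw : w + 2 ≤ 2 ^ b) (he : Even n) :
    SS n b := by
  obtain ⟨v, hv⟩ := he
  refine SS_gen {0} ?_ (by simp) (n + 1) (by simp) (by omega) (by rw [pow_succ]; omega) ?_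
  · simp; omega
  · intro i hi
    simp only [Finset.mem_singleton] at hi
    subst hi
    exact tb 0 v (by simp) (by omega)

lemma gen_a {n b n0 : ℕ} (hb : 2 ≤ b) (hn : n = 2 ^ b + 2 ^ (b - 1) + n0)
    (h0 : n0 + 4 ≤ 2 ^ (b - 1)) (he : Even n) : SS n (2 * b - 1) := by
  obtain ⟨v, hv⟩ := he
  obtain ⟨c, rfl⟩ : ∃ c, b = c + 1 := ⟨b - 1, by omega⟩
  simp only [Nat.add_sub_cancel] at *
  have e1 : 2 * (c + 1) - 1 = 2 * c + 1 := by omega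
  rw [e1]
  have hP : 2 ^ (c + 1) = 2 * 2 ^ c := by ring
  have hP2 : 2 ^ (2 * c + 1) = 2 * (2 ^ c * 2 ^ c) := by ring
  have hP3 : 2 ^ (2 * c + 1 + 1) = 4 * (2 ^ c * 2 ^ c) := by ring
  have hPe : 2 ^ c = 2 * 2 ^ (c - 1) := by
    rw [← pow_succ', Nat.sub_add_cancel (by omega)]
  refine SS_gen {0, c} ?_ (by simp) (n * (1 + 2 ^ c) + 1) ?_ ?_ ?_ ?_
  · intro i; simp only [Finset.mem_insert, Finset.mem_singleton, Finset.mem_range]; omega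
  · rw [Finset.sum_pair (by omega)]; simp
  · rw [hP2, hn, hP]; nlinarith
  · rw [hP3, hn, hP]; nlinarith
  · intro i hi
    simp only [Finset.mem_insert, Finset.mem_singleton] at hi
    rcases hi with rfl | rfl
    · exact tb 0 (v * (1 + 2 ^ c)) (by simp) (by rw [hv]; ring)
    · refine tb (n0 + 1) (v + 1) (by omega) ?_
      have : n * (1 + 2 ^ i) + 1 = n + 1 + 2 ^ i * n := by ring
      rw [this]
      nth_rewrite 1 [hn]
      rw [hP, hv]
      ring

lemma gen_b {n b : ℕ} (hb : 3 ≤ b) (hn : n + 2 = 2 ^ (b + 1)) : SS n (2 * b - 1) := by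
  obtain ⟨c, rfl⟩ : ∃ c, b = c + 2 := ⟨b - 2, by omega⟩
  have e1 : 2 * (c + 2) - 1 = 2 * c + 3 := by omega
  rw [e1]
  have hP : 2 ^ (c + 2 + 1) = 8 * 2 ^ c := by ring
  have hP2 : 2 ^ (2 * c + 3) = 8 * (2 ^ c * 2 ^ c) := by ring
  have hP3 : 2 ^ (2 * c + 3 + 1) = 16 * (2 ^ c * 2 ^ c) := by ring
  have hc1 : 2 ≤ 2 ^ c := by
    calc 2 = 2 ^ 1 := by norm_num
      _ ≤ 2 ^ c := Nat.pow_le_pow_right (by norm_num) (by omega)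
  obtain ⟨r, hr⟩ : ∃ r, 2 ^ c = r + 1 := ⟨2 ^ c - 1, by omega⟩
  have hn' : n = 8 * r + 6 := by omega
  refine SS_gen {0, c} ?_ (by simp) (n * (1 + 2 ^ c) + 1) ?_ ?_ ?_ ?_
  · intro i; simp only [Finset.mem_insert, Finset.mem_singleton, Finset.mem_range]; omega
  · rw [Finset.sum_pair (by omega)]; simp
  · rw [hP2, hn', hr]; nlinarith
  · rw [hP3, hn', hr]; nlinarith
  · intro i hi
    simp only [Finset.mem_insert, Finset.mem_singleton] at hi
    rcases hi with rfl | rfl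
    · exact tb 0 ((4 * r + 3) * (1 + 2 ^ c)) (by simp) (by rw [hn']; ring)
    · refine tb r (4 * r + 6) (by omega) ?_
      rw [hn', hr]; ring

lemma gen_c {n b p n0 : ℕ} (hp : 1 ≤ p) (hb : p + 2 ≤ b) (hn : n = 2 ^ b + 2 ^ p + n0)
    (h0 : n0 + 2 ≤ 2 ^ p) (he : Even n) (hbit : n.testBit (b - p) = true) :
    SS n (2 * b + 1) := by
  obtain ⟨v, hv⟩ := he
  obtain ⟨c, rfl⟩ : ∃ c, b = p + 2 + c := ⟨b - p - 2, by omega⟩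
  have e1 : p + 2 + c - p = c + 2 := by omega
  rw [e1] at hbit
  have hP : 2 ^ (p + 2 + c) = 4 * (2 ^ p * 2 ^ c) := by ring
  have hP1 : 2 ^ (p + 2 + c + 1) = 8 * (2 ^ p * 2 ^ c) := by ring
  have hP2 : 2 ^ (2 * (p + 2 + c) + 1) = 32 * (2 ^ p * 2 ^ c) * (2 ^ p * 2 ^ c) := by ring
  have hP3 : 2 ^ (2 * (p + 2 + c) + 1 + 1) = 64 * (2 ^ p * 2 ^ c) * (2 ^ p * 2 ^ c) := by ring
  have hP4 : 2 ^ (c + 2) = 4 * 2 ^ c := by ring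
  have hp2 : 2 ≤ 2 ^ p := by
    calc 2 = 2 ^ 1 := by norm_num
      _ ≤ 2 ^ p := Nat.pow_le_pow_right (by norm_num) (by omega)
  have hc1 : 1 ≤ 2 ^ c := Nat.one_le_two_pow
  have hN : n * (1 + 4 * 2 ^ c + 8 * (2 ^ p * 2 ^ c)) + 1 =
      n + 1 + 2 ^ (c + 2) * n + 2 ^ (p + 2 + c + 1) * n := by rw [hP1, hP4]; ring
  rw [hP] at hn
  refine SS_gen {0, c + 2, p + 2 + c + 1} ?_ (by simp)
    (n * (1 + 4 * 2 ^ c + 8 * (2 ^ p * 2 ^ c)) + 1) ?_ ?_ ?_ ?_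
  · intro i; simp only [Finset.mem_insert, Finset.mem_singleton, Finset.mem_range]; omega
  · rw [Finset.sum_insert (by simp), Finset.sum_pair (by omega), hP1, hP4]
    ring
  · rw [hP2]
    calc _ ≤ (4 * (2 ^ p * 2 ^ c)) * (8 * (2 ^ p * 2 ^ c)) := by nlinarith
      _ ≤ n * (1 + 4 * 2 ^ c + 8 * (2 ^ p * 2 ^ c)) := by
        apply Nat.mul_le_mul <;> omega
      _ ≤ _ := by omega
  · rw [hP3]
    set P := 2 ^ p
    set C := 2 ^ c
    have hPC : P ≤ P * C := Nat.le_mul_of_pos_right _ hc1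
    have hPC2 : C * 2 ≤ P * C := by rw [mul_comm P]; exact Nat.mul_le_mul_left _ hp2
    have hn1 : n + 2 ≤ 6 * (P * C) := by omega
    have hk : 1 + 4 * C + 8 * (P * C) ≤ 10 * (P * C) + 1 := by omega
    calc _ ≤ (6 * (P * C)) * (10 * (P * C) + 1) := by nlinarith
      _ < _ := by nlinarith
  · intro i hi
    simp only [Finset.mem_insert, Finset.mem_singleton] at hi
    rcases hi with rfl | rfl | rfl
    · exact tb 0 (v * (1 + 4 * 2 ^ c + 8 * (2 ^ p * 2 ^ c))) (by simp) (by rw [hv]; ring)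
    · rw [Nat.testBit_eq_decide_div_mod_eq, decide_eq_true_iff] at hbit
      have hdm := Nat.div_add_mod n (2 ^ (c + 2))
      have hlt := Nat.mod_lt n (show 0 < 2 ^ (c + 2) by positivity)
      have hmod : n % 2 ^ (c + 2) + 1 < 2 ^ (c + 2) := by
        have h2 : (n % 2 ^ (c + 2)) % 2 = n % 2 :=
          Nat.mod_mod_of_dvd n (dvd_pow_self 2 (by omega))
        rw [hP4] at h2 hlt ⊢
        omega
      set D := n / 2 ^ (c + 2)
      refine tb (n % 2 ^ (c + 2) + 1) (D / 2 + v + 2 ^ p * n) hmod ?_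
      rw [hN]
      have hD : 2 * (D / 2) + 1 = D := by omega
      have e2 : 2 * (D / 2 + v + 2 ^ p * n) + 1 = D + n + 2 * 2 ^ p * n := by
        have e4 : 2 * 2 ^ p * n = 2 * (2 ^ p * n) := by ring
        omega
      rw [e2]
      have e3 : 2 ^ (p + 2 + c + 1) = 2 ^ (c + 2) * (2 * 2 ^ p) := by ring
      rw [e3]
      nth_rewrite 1 [← hdm]
      ring
    · refine tb (2 ^ p + n0 + 1 + n0 * (4 * 2 ^ c)) (2 ^ c + v) ?_ ?_
      · rw [hP1]; nlinarith
      · rw [hN, hP4, hP1]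
        have : 2 * (2 ^ c + v) + 1 = 2 * 2 ^ c + n + 1 := by omega
        rw [this]
        have h2 : n + 1 + 4 * 2 ^ c * n = (2 ^ p + n0 + 1 + n0 * (4 * 2 ^ c)) +
            8 * (2 ^ p * 2 ^ c) * (2 * 2 ^ c + 1) := by
          rw [hn]; ring
        rw [h2]; ring

lemma gen_d {n b p n0 : ℕ} (hp : 1 ≤ p) (hb : p + 2 ≤ b) (hn : n = 2 ^ b + 2 ^ p + n0)
    (h0 : n0 + 2 ≤ 2 ^ p) (he : Even n) : SS n (b + p) := by
  obtain ⟨v, hv⟩ := he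
  obtain ⟨c, rfl⟩ : ∃ c, b = p + 2 + c := ⟨b - p - 2, by omega⟩
  have hP : 2 ^ (p + 2 + c) = 4 * (2 ^ p * 2 ^ c) := by ring
  have hP2 : 2 ^ (p + 2 + c + p) = 4 * (2 ^ p * 2 ^ c) * 2 ^ p := by ring
  have hP3 : 2 ^ (p + 2 + c + p + 1) = 8 * (2 ^ p * 2 ^ c) * 2 ^ p := by ring
  have hp2 : 2 ≤ 2 ^ p := by
    calc 2 = 2 ^ 1 := by norm_num
      _ ≤ 2 ^ p := Nat.pow_le_pow_right (by norm_num) (by omega)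
  have hc1 : 1 ≤ 2 ^ c := Nat.one_le_two_pow
  rw [hP] at hn
  refine SS_gen {0, p} ?_ (by simp) (n * (1 + 2 ^ p) + 1) ?_ ?_ ?_ ?_
  · intro i; simp only [Finset.mem_insert, Finset.mem_singleton, Finset.mem_range]; omega
  · rw [Finset.sum_pair (by omega)]; simp
  · rw [hP2]
    have : (4 * (2 ^ p * 2 ^ c)) * 2 ^ p ≤ n * (1 + 2 ^ p) := Nat.mul_le_mul (by omega) (by omega)
    omega
  · rw [hP3]
    set P := 2 ^ p
    set C := 2 ^ c
    have hPC : P ≤ P * C := Nat.le_mul_of_pos_right _ hc1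
    have hn1 : n + 2 ≤ 4 * (P * C) + 2 * P := by omega
    obtain ⟨r, hr⟩ : ∃ r, P = r + 2 := ⟨P - 2, by omega⟩
    have h3 : n * (1 + P) + 2 * (1 + P) ≤ (4 * (P * C) + 2 * P) * (1 + P) := by
      rw [← add_mul]; exact Nat.mul_le_mul_right _ hn1
    have h4 : P * P ≤ P * C * P := Nat.mul_le_mul_right _ hPC
    have h5 : P * C * 2 ≤ P * C * P := Nat.mul_le_mul_left _ hp2
    have h6 : (4 * (P * C) + 2 * P) * (1 + P) = 4 * (P * C) + 2 * P + 4 * (P * C * P) + 2 * (P * P) := by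
      ring
    have h7 : 8 * (P * C) * P = 8 * (P * C * P) := by ring
    rw [h7]
    omega
  · intro i hi
    simp only [Finset.mem_insert, Finset.mem_singleton] at hi
    rcases hi with rfl | rfl
    · exact tb 0 (v * (1 + 2 ^ p)) (by simp) (by rw [hv]; ring)
    · refine tb (n0 + 1) (2 * 2 ^ c + v) (by omega) ?_
      have e1 : n * (1 + 2 ^ i) + 1 = n + 1 + 2 ^ i * n := by ring
      have e2 : 2 * (2 * 2 ^ c + v) + 1 = 4 * 2 ^ c + n + 1 := by omega
      rw [e1, e2]
      nth_rewrite 1 [hn]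
      ring

lemma gen_e {n b p n0 : ℕ} (hp : 1 ≤ p) (hb : p + 2 ≤ b) (hn : n = 2 ^ b + 2 ^ p + n0)
    (h0 : n0 + 2 ≤ 2 ^ p) (he : Even n) (hbit : n.testBit (b - p) = false) :
    SS n (2 * b + p + 1) := by
  obtain ⟨v, hv⟩ := he
  obtain ⟨c, rfl⟩ : ∃ c, b = p + 2 + c := ⟨b - p - 2, by omega⟩
  have e1 : p + 2 + c - p = c + 2 := by omega
  rw [e1] at hbit
  have hP : 2 ^ (p + 2 + c) = 4 * (2 ^ p * 2 ^ c) := by ring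
  have hP1 : 2 ^ (p + 2 + c + p + 1) = 8 * (2 ^ p * 2 ^ c) * 2 ^ p := by ring
  have hP2 : 2 ^ (2 * (p + 2 + c) + p + 1) = 32 * (2 ^ p * 2 ^ c) * (2 ^ p * 2 ^ c) * 2 ^ p := by ring
  have hP3 : 2 ^ (2 * (p + 2 + c) + p + 1 + 1) =
    64 * (2 ^ p * 2 ^ c) * (2 ^ p * 2 ^ c) * 2 ^ p := by ring
  have hP4 : 2 ^ (c + 2) = 4 * 2 ^ c := by ring
  have hp2 : 2 ≤ 2 ^ p := by
    calc 2 = 2 ^ 1 := by norm_num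
      _ ≤ 2 ^ p := Nat.pow_le_pow_right (by norm_num) (by omega)
  have hc1 : 1 ≤ 2 ^ c := Nat.one_le_two_pow
  have hN : n * (1 + 2 ^ p + 4 * (2 ^ p * 2 ^ c) + 8 * (2 ^ p * 2 ^ c) * 2 ^ p) + 1 =
      n + 1 + 2 ^ p * n + 4 * (2 ^ p * 2 ^ c) * n + 8 * (2 ^ p * 2 ^ c) * 2 ^ p * n := by ring
  rw [hP] at hn
  -- bit `c+2` of `n0 + 2^p + 1`
  have hdm := Nat.div_add_mod n (2 ^ (c + 2))
  have hlt := Nat.mod_lt n (show 0 < 2 ^ (c + 2) by positivity)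
  have hmod : n % 2 ^ (c + 2) + 1 < 2 ^ (c + 2) := by
    have h2 : (n % 2 ^ (c + 2)) % 2 = n % 2 :=
      Nat.mod_mod_of_dvd n (dvd_pow_self 2 (by omega))
    rw [hP4] at h2 hlt ⊢
    omega
  rw [Nat.testBit_eq_decide_div_mod_eq, decide_eq_false_iff_not] at hbit
  refine SS_gen {0, p, p + 2 + c, p + 2 + c + p + 1} ?_ (by simp)
    (n * (1 + 2 ^ p + 4 * (2 ^ p * 2 ^ c) + 8 * (2 ^ p * 2 ^ c) * 2 ^ p) + 1) ?_ ?_ ?_ ?_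
  · intro i; simp only [Finset.mem_insert, Finset.mem_singleton, Finset.mem_range]; omega
  · rw [Finset.sum_insert (by simp; omega), Finset.sum_insert (by simp; omega),
      Finset.sum_pair (by omega), hP1, hP]
    ring
  · rw [hP2]
    calc _ = (4 * (2 ^ p * 2 ^ c)) * (8 * (2 ^ p * 2 ^ c) * 2 ^ p) := by ring
      _ ≤ n * (1 + 2 ^ p + 4 * (2 ^ p * 2 ^ c) + 8 * (2 ^ p * 2 ^ c) * 2 ^ p) := by
        apply Nat.mul_le_mul
        · omega
        · exact Nat.le_add_left _ _
      _ ≤ _ := by omega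
  · rw [hP3]
    set P := 2 ^ p
    set C := 2 ^ c
    set Z := P * C with hZ
    have hPC : P ≤ Z := Nat.le_mul_of_pos_right _ hc1
    have hn1 : n + 2 ≤ 6 * Z := by omega
    have h5 : Z * 2 ≤ Z * P := Nat.mul_le_mul_left _ hp2
    have h6 : 2 * Z ≤ Z * Z := Nat.mul_le_mul_right _ (by omega)
    have h1 : n * (1 + P + 4 * Z + 8 * Z * P) + 2 * (1 + P + 4 * Z + 8 * Z * P) ≤
        6 * Z * (1 + P + 4 * Z + 8 * Z * P) := by
      rw [← add_mul]; exact Nat.mul_le_mul_right _ hn1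
    have h2 : 6 * Z * (1 + P + 4 * Z + 8 * Z * P) =
      6 * Z + 6 * (Z * P) + 24 * (Z * Z) + 48 * (Z * Z * P) := by ring
    have h3 : Z * Z * 2 ≤ Z * Z * P := Nat.mul_le_mul_left _ hp2
    have h4 : 2 * Z * P ≤ Z * Z * P := Nat.mul_le_mul_right _ h6
    have h7 : 2 * Z * P = 2 * (Z * P) := by ring
    have h8 : 64 * Z * Z * P = 64 * (Z * Z * P) := by ring
    have h9 : 8 * Z * P = 8 * (Z * P) := by ring
    rw [h8]
    rw [h9] at h1 h2 ⊢
    omega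
  · intro i hi
    simp only [Finset.mem_insert, Finset.mem_singleton] at hi
    rcases hi with rfl | rfl | rfl | rfl
    · exact tb 0 (v * (1 + 2 ^ p + 4 * (2 ^ p * 2 ^ c) + 8 * (2 ^ p * 2 ^ c) * 2 ^ p))
        (by simp) (by rw [hv]; ring)
    · refine tb (n0 + 1) (2 * 2 ^ c + v + 4 * 2 ^ c * v + 8 * (2 ^ i * 2 ^ c) * v) (by omega) ?_
      rw [hN]
      nth_rewrite 1 [hn]
      rw [hv]
      ring
    · set D := n / 2 ^ (c + 2)
      refine tb (2 ^ p * (n % 2 ^ (c + 2) + 1) + n0 + 1) (D / 2 + v + 2 ^ p * n) ?_ ?_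
      · have h1 : 2 ^ p * (n % 2 ^ (c + 2) + 1 + 1) ≤ 2 ^ p * 2 ^ (c + 2) :=
          Nat.mul_le_mul_left _ hmod
        have h2 : 2 ^ p * 2 ^ (c + 2) = 4 * (2 ^ p * 2 ^ c) := by ring
        rw [hP, ← h2]
        rw [mul_add _ _ 1] at h1
        omega
      · have e2 : 2 * (D / 2 + v + 2 ^ p * n) + 1 = D + n + 2 * (2 ^ p * n) + 1 := by omega
        rw [hN, e2, hP]
        have e3 : n + 1 + 2 ^ p * n = 4 * (2 ^ p * 2 ^ c) + n0 + 1 + 2 ^ p * (n + 1) := by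
          have : 2 ^ p * (n + 1) = 2 ^ p * n + 2 ^ p := by ring
          omega
        have e4 : n + 1 = 4 * 2 ^ c * D + (n % 2 ^ (c + 2) + 1) := by
          rw [← hP4]; omega
        rw [e3, e4]
        ring
    · refine tb (4 * (2 ^ p * 2 ^ c) * (n0 + 1) + (n0 + 1) + 2 ^ p * (2 ^ p + n0 + 1))
        (2 ^ c + v) ?_ ?_
      · rw [hP1]
        set P := 2 ^ p
        set C := 2 ^ c
        set Z := P * C with hZ
        have hPC : P ≤ Z := Nat.le_mul_of_pos_right _ hc1
        have h1 : 4 * Z * (n0 + 1 + 1) ≤ 4 * Z * P := Nat.mul_le_mul_left _ h0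
        have h2 : P * (P + n0 + 1) ≤ Z * (2 * P) := Nat.mul_le_mul hPC (by omega)
        have h3 : 4 * Z * P = 4 * (Z * P) := by ring
        have h4 : Z * (2 * P) = 2 * (Z * P) := by ring
        have h5 : 8 * Z * P = 8 * (Z * P) := by ring
        have h6 : 4 * Z * (n0 + 1 + 1) = 4 * Z * (n0 + 1) + 4 * Z := by ring
        omega
      · rw [hN, hP1]
        have e2 : 2 * (2 ^ c + v) + 1 = 2 * 2 ^ c + n + 1 := by omega
        rw [e2]
        have e3 : n + 1 + 2 ^ p * n + 4 * (2 ^ p * 2 ^ c) * n =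
          (4 * (2 ^ p * 2 ^ c) * (n0 + 1) + (n0 + 1) + 2 ^ p * (2 ^ p + n0 + 1)) +
            8 * (2 ^ p * 2 ^ c) * 2 ^ p * (2 * 2 ^ c + 1) := by
          rw [hn]; ring
        rw [e3]; ring

lemma SS_large {n : ℕ} (h2 : 2 ≤ n) (he : Even n) (hpow : ∀ k, n ≠ 2 ^ k) (h6 : n ≠ 6) :
    ∃ m0, ∀ m ≥ m0, SS n m := by
  obtain ⟨b, w, hw, hwb⟩ := exists_top (w := n) (by omega)
  have hw0 : w ≠ 0 := by
    rintro rfl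
    exact hpow b (by simpa using hw)
  obtain ⟨p, n0, hp, hn0⟩ := exists_top hw0
  have hb1 : 1 ≤ b := by
    rcases Nat.eq_zero_or_pos b with rfl | h
    · simp at hwb; omega
    · exact h
  have hbe : 2 ^ b = 2 * 2 ^ (b - 1) := by rw [← pow_succ', Nat.sub_add_cancel hb1]
  have hpb : p < b := by
    apply (Nat.pow_lt_pow_iff_right (by norm_num : 1 < 2)).mp
    omega
  have he' := he
  obtain ⟨v, hv⟩ := he
  have hp1 : 1 ≤ p := by
    rcases Nat.eq_zero_or_pos p with rfl | h
    · simp at hn0 hp; omega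
    · exact h
  have hpe : 2 ^ p = 2 * 2 ^ (p - 1) := by rw [← pow_succ', Nat.sub_add_cancel hp1]
  have hn02 : n0 + 2 ≤ 2 ^ p := by omega
  have hn : n = 2 ^ b + 2 ^ p + n0 := by omega
  have g1 : SS n b := gen_one hb1 hw (by omega) he'
  by_cases hpb1 : p = b - 1
  · have hcop : Nat.gcd b (2 * b - 1) = 1 := by
      have h1 := Nat.gcd_dvd_left b (2 * b - 1)
      have h3 := Nat.gcd_dvd_right b (2 * b - 1)
      have h4 := (Nat.dvd_sub (h1.mul_left 2) h3)
      rw [show 2 * b - (2 * b - 1) = 1 by omega] at h4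
      exact Nat.eq_one_of_dvd_one h4
    by_cases h4 : n0 + 4 ≤ 2 ^ p
    · refine SS_coprime g1 (gen_a (by omega) (by rw [hn, hpb1]) (by rw [← hpb1]; exact h4) he') hcop
    · have hb3 : 3 ≤ b := by
        by_contra hb3
        have : b = 2 := by omega
        subst this
        simp at hpb1
        subst hpb1
        simp at hn hn02
        omega
      have : n0 % 2 = 0 := by omega
      refine SS_coprime g1 (gen_b hb3 ?_) hcop
      rw [pow_succ]
      rw [← hpb1] at hbe
      have : 2 ^ (p - 1) = 2 * 2 ^ (p - 1 - 1) := by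
        rw [← pow_succ', Nat.sub_add_cancel (by omega)]
      omega
  · have hb2 : p + 2 ≤ b := by omega
    cases hbit : n.testBit (b - p)
    · refine SS_coprime (SS_add g1 (gen_d hp1 hb2 hn hn02 he'))
        (gen_e hp1 hb2 hn hn02 he' hbit) ?_
      rw [show 2 * b + p + 1 = b + (b + p) + 1 by ring]
      simp
    · refine SS_coprime g1 (gen_c hp1 hb2 hn hn02 he' hbit) ?_
      have h1 := Nat.gcd_dvd_left b (2 * b + 1)
      have h3 := Nat.gcd_dvd_right b (2 * b + 1)
      have h4 := (Nat.dvd_sub h3 (h1.mul_left 2))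
      rw [show 2 * b + 1 - 2 * b = 1 by omega] at h4
      exact Nat.eq_one_of_dvd_one h4

end OPolyAux

namespace OPolyAux

lemma SS_six_even (t : ℕ) : SS 6 (2 * t + 2) := by
  have h2 : SS 6 2 := ⟨{0}, ∅, by simp, by simp, by simp, by simp, by simp⟩
  induction t with
  | zero => simpa using h2
  | succ t ih => exact SS_add ih h2

def A6 (t : ℕ) : Finset ℕ := insert 0 ((Finset.range (t + 1)).image (fun j => 2 * j + 1))

lemma A6_sum (t : ℕ) : 3 * ∑ i ∈ A6 t, 2 ^ i = 2 ^ (2 * t + 3) + 1 := by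
  have h : 3 * ∑ j ∈ Finset.range (t + 1), 2 ^ (2 * j + 1) + 2 = 2 ^ (2 * t + 3) := by
    induction t with
    | zero => simp
    | succ t ih =>
      rw [Finset.sum_range_succ, mul_add]
      rw [show 2 ^ (2 * (t + 1) + 3) = 4 * 2 ^ (2 * t + 3) by ring, ← ih]
      rw [show 2 ^ (2 * (t + 1) + 1) = 2 ^ (2 * t + 3) by ring, ← ih]
      ring
  rw [A6, Finset.sum_insert (by simp), Finset.sum_image (by intro a _ b _ h; simpa using h)]
  rw [← h]; simp; ring

lemma six_rel {K : Type*} [Field K] [Fintype K] [CharP K 2] {t : ℕ}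
    (hc : Fintype.card K = 2 ^ (2 * t + 3)) {f : K[X]} (hf : IsOPoly K f)
    (hdeg : f.natDegree = 6) (h6 : 6 < 2 ^ (2 * t + 3) - 1) :
    f.coeff 4 ^ 2 = f.coeff 2 * f.coeff 6 := by
  classical
  have hT : f.support ⊆ {2, 4, 6} := by
    intro e he
    have h1 := support_even (by omega) hc hf (by omega) he
    have h2 := Polynomial.le_natDegree_of_mem_supp e he
    rw [hdeg] at h2
    have h3 : e ≠ 0 := by
      rintro rfl
      have := hf.2.2.1
      rw [← Polynomial.coeff_zero_eq_eval_zero] at this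
      rw [Polynomial.mem_support_iff] at he
      exact he this
    interval_cases e <;> simp_all <;> revert h1 <;> decide
  have h0A : 0 ∈ A6 t := by simp [A6]
  have h1A : 1 ∈ A6 t := by simp [A6]
  have h := glynn_coeff hc hf (A := A6 t) (L := ∅) (by
    intro i hi
    simp only [A6, Finset.mem_insert, Finset.mem_image, Finset.mem_range] at hi ⊢
    rcases hi with rfl | ⟨j, hj, rfl⟩ <;> omega) (by simp) (by simp) ⟨0, h0A⟩ (by
    intro h
    have : 2 ∈ A6 t := by rw [h]; simp
    simp [A6] at this) hT (by simp)
  let z0 : A6 t := ⟨0, h0A⟩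
  let z1 : A6 t := ⟨1, h1A⟩
  have hz : z0 ≠ z1 := by simp [z0, z1]
  let e1 : A6 t → ℕ := fun a => if a = z0 then 2 else 6
  let e2 : A6 t → ℕ := fun a => if a = z1 then 4 else 6
  have he1 : e1 ∈ Fintype.piFinset (fun _ : A6 t => ({2, 4, 6} : Finset ℕ)) := by
    rw [Fintype.mem_piFinset]; intro a; simp only [e1]; split_ifs <;> simp
  have he2 : e2 ∈ Fintype.piFinset (fun _ : A6 t => ({2, 4, 6} : Finset ℕ)) := by
    rw [Fintype.mem_piFinset]; intro a; simp only [e2]; split_ifs <;> simp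
  have hks : ∑ a : A6 t, 2 ^ (a : ℕ) = ∑ i ∈ A6 t, 2 ^ i :=
    Finset.sum_coe_sort (A6 t) (fun a => 2 ^ a)
  have hk := A6_sum t
  rw [← hks] at hk
  have hne : e1 ≠ e2 := by
    intro h
    have := congrFun h z0
    simp [e1, e2, hz] at this
  have hpw : 2 ^ (2 * t + 3) = 2 * 2 ^ (2 * t + 2) := by ring
  have split : ∀ g : A6 t → ℕ, ∑ a, g a = g z0 + g z1 + ∑ a ∈ (Finset.univ.erase z0).erase z1, g a := by
    intro g
    rw [← Finset.add_sum_erase Finset.univ g (Finset.mem_univ z0),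
      ← Finset.add_sum_erase _ g (show z1 ∈ Finset.univ.erase z0 by simp [hz.symm])]
    ring
  have psplit : ∀ g : A6 t → K, ∏ a, g a = g z0 * g z1 * ∏ a ∈ (Finset.univ.erase z0).erase z1, g a := by
    intro g
    rw [← Finset.mul_prod_erase Finset.univ g (Finset.mem_univ z0),
      ← Finset.mul_prod_erase _ g (show z1 ∈ Finset.univ.erase z0 by simp [hz.symm])]
    ring
  have hs1 : ∑ a : A6 t, 2 ^ (a : ℕ) * e1 a + 4 = 6 * ∑ a : A6 t, 2 ^ (a : ℕ) := by
    rw [split, split (fun a => 2 ^ (a : ℕ)), mul_add, Finset.mul_sum]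
    have : ∑ a ∈ (Finset.univ.erase z0).erase z1, 2 ^ (a : ℕ) * e1 a =
        ∑ a ∈ (Finset.univ.erase z0).erase z1, 6 * 2 ^ (a : ℕ) := by
      refine Finset.sum_congr rfl fun a ha => ?_
      simp only [Finset.mem_erase] at ha
      simp [e1, ha.2.1, mul_comm]
    rw [this]
    simp [e1, z0, z1]
    ring
  have hs2 : ∑ a : A6 t, 2 ^ (a : ℕ) * e2 a + 4 = 6 * ∑ a : A6 t, 2 ^ (a : ℕ) := by
    rw [split, split (fun a => 2 ^ (a : ℕ)), mul_add, Finset.mul_sum]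
    have : ∑ a ∈ (Finset.univ.erase z0).erase z1, 2 ^ (a : ℕ) * e2 a =
        ∑ a ∈ (Finset.univ.erase z0).erase z1, 6 * 2 ^ (a : ℕ) := by
      refine Finset.sum_congr rfl fun a ha => ?_
      simp only [Finset.mem_erase] at ha
      simp [e2, ha.1, mul_comm]
    rw [this]
    simp [e2, z0, z1]
    ring
  have hmain : ∀ e ∈ Fintype.piFinset (fun _ : A6 t => ({2, 4, 6} : Finset ℕ)), e ≠ e1 → e ≠ e2 →
      ¬ (2 ^ (2 * t + 3) - 1 ∣ ∑ a : A6 t, 2 ^ (a : ℕ) * e a + ∑ i ∈ (∅ : Finset ℕ), 2 ^ i) := by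
    intro e he hn1 hn2 hd
    rw [Fintype.mem_piFinset] at he
    have he' : ∀ a, e a = 2 ∨ e a = 4 ∨ e a = 6 := by
      intro a; simpa using he a
    rw [Finset.sum_empty, add_zero] at hd
    have hle : ∑ a : A6 t, 2 ^ (a : ℕ) * e a + ∑ a : A6 t, 2 ^ (a : ℕ) * (6 - e a) =
        6 * ∑ a : A6 t, 2 ^ (a : ℕ) := by
      rw [← Finset.sum_add_distrib, Finset.mul_sum]
      refine Finset.sum_congr rfl fun a _ => ?_
      rw [← mul_add, mul_comm]
      congr 1
      rcases he' a with h | h | h <;> omega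
    have hev : Even (∑ a : A6 t, 2 ^ (a : ℕ) * e a) := by
      apply Finset.even_sum
      intro a _
      apply Even.mul_left
      rcases he' a with h | h | h <;> rw [h] <;> decide
    have hpos : 0 < ∑ a : A6 t, 2 ^ (a : ℕ) * e a := by
      rw [split]
      have : 0 < 2 ^ (z0 : ℕ) * e z0 := by
        apply Nat.mul_pos (by positivity)
        rcases he' z0 with h | h | h <;> omega
      omega
    have h4 : ∑ a : A6 t, 2 ^ (a : ℕ) * (6 - e a) = 4 := by
      obtain ⟨q, hq⟩ := hd
      obtain ⟨y, hy⟩ := hev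
      rcases q with _ | _ | _ | q
      · omega
      · omega
      · omega
      · have : (2 ^ (2 * t + 3) - 1) * 3 ≤ (2 ^ (2 * t + 3) - 1) * (q + 1 + 1 + 1) :=
          Nat.mul_le_mul_left _ (by omega)
        omega
    have hbig : ∀ a : A6 t, a ≠ z0 → a ≠ z1 → e a = 6 := by
      intro a h0 h1
      have h2 : 2 ^ (a : ℕ) * (6 - e a) ≤ 4 := by
        rw [← h4]
        exact Finset.single_le_sum (f := fun a : A6 t => 2 ^ (a : ℕ) * (6 - e a))
          (fun _ _ => Nat.zero_le _) (Finset.mem_univ a)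
      have ha0 : (a : ℕ) ≠ 0 := fun h => h0 (Subtype.ext h)
      have ha1 : (a : ℕ) ≠ 1 := fun h => h1 (Subtype.ext h)
      have h3 : 2 ^ 2 ≤ 2 ^ (a : ℕ) := Nat.pow_le_pow_right (by norm_num) (by omega)
      rcases he' a with h | h | h
      · rw [h] at h2; omega
      · rw [h] at h2; omega
      · exact h
    rw [split, Finset.sum_eq_zero (by
      intro a ha
      simp only [Finset.mem_erase] at ha
      rw [hbig a ha.2.1 ha.1, Nat.sub_self, mul_zero])] at h4
    simp only [z0, z1, pow_zero, pow_one, one_mul, add_zero] at h4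
    rcases he' z0 with h | h | h
    · apply hn1
      funext a
      by_cases h0 : a = z0
      · simp [e1, h0, h]
      · simp only [e1, if_neg h0]
        by_cases h1 : a = z1
        · rw [h1]
          rcases he' z1 with h' | h' | h' <;> simp only [z0, z1] at h h' ⊢ <;> omega
        · exact hbig a h0 h1
    · rcases he' z1 with h' | h' | h' <;> simp only [z0, z1] at h h' <;> omega
    · apply hn2
      funext a
      by_cases h1 : a = z1
      · simp only [e2, h1, if_true]
        rcases he' z1 with h' | h' | h' <;> simp only [z0, z1] at h h' ⊢ <;> omega
      · simp only [e2, if_neg h1]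
        by_cases h0 : a = z0
        · rw [h0, h]
        · exact hbig a h0 h1
  have hd2 : 2 ^ (2 * t + 3) - 1 ∣ 6 * ∑ a : A6 t, 2 ^ (a : ℕ) - 4 := ⟨2, by omega⟩
  rw [Finset.sum_eq_add_of_mem e1 e2 he1 he2 hne (by
    intro e he hh
    rw [if_neg (hmain e he hh.1 hh.2)])] at h
  rw [Finset.sum_empty, add_zero, add_zero, if_pos (by rw [← hs1] at hd2; simpa using hd2),
    if_pos (by rw [← hs2] at hd2; simpa using hd2)] at h
  rw [psplit, psplit (fun a => f.coeff (e2 a) ^ 2 ^ (a : ℕ))] at h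
  have hp1 : ∏ a ∈ (Finset.univ.erase z0).erase z1, f.coeff (e1 a) ^ 2 ^ (a : ℕ) =
      ∏ a ∈ (Finset.univ.erase z0).erase z1, f.coeff 6 ^ 2 ^ (a : ℕ) := by
    refine Finset.prod_congr rfl fun a ha => ?_
    simp only [Finset.mem_erase] at ha
    simp [e1, ha.2.1]
  have hp2 : ∏ a ∈ (Finset.univ.erase z0).erase z1, f.coeff (e2 a) ^ 2 ^ (a : ℕ) =
      ∏ a ∈ (Finset.univ.erase z0).erase z1, f.coeff 6 ^ 2 ^ (a : ℕ) := by
    refine Finset.prod_congr rfl fun a ha => ?_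
    simp only [Finset.mem_erase] at ha
    simp [e2, ha.1]
  rw [hp1, hp2, ← add_mul] at h
  have hc6 : f.coeff 6 ≠ 0 := by
    have : f ≠ 0 := by rintro rfl; simp at hdeg
    have := Polynomial.natDegree_mem_support_of_nonzero this
    rw [hdeg] at this
    simpa using this
  have hpn : ∏ a ∈ (Finset.univ.erase z0).erase z1, f.coeff 6 ^ 2 ^ (a : ℕ) ≠ 0 :=
    Finset.prod_ne_zero_iff.mpr fun a _ => pow_ne_zero _ hc6
  have h' := (mul_eq_zero.mp h).resolve_right hpn
  simp [e1, e2, z0, z1] at h'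
  apply mul_left_cancel₀ hc6
  have h2 : (2 : K) = 0 := CharTwo.two_eq_zero
  linear_combination h' - f.coeff 2 * f.coeff 6 ^ 2 * h2

end OPolyAux

namespace OPolyAux

/-! ### Periodic carries -/

lemma carry {m : ℕ} (hm : 1 ≤ m) (t : ℕ → ℕ) (per : ∀ z, t (z + m) = t z)
    (hpos : ∃ z, t z ≠ 0) (hb : ∀ z, t z ≤ 3)
    (hdiv : 2 ^ m - 1 ∣ ∑ x ∈ Finset.range m, 2 ^ x * t x) :
    ∃ τ : ℕ → ℕ, (∀ z, 2 * τ (z + 1) = τ z + t z) ∧ ∀ z, 1 ≤ τ z ∧ τ z ≤ 3 := by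
  let S : ℕ → ℕ := fun z => ∑ x ∈ Finset.range m, 2 ^ x * t (z + x)
  have hM : 1 ≤ 2 ^ m - 1 := by
    have : 2 ^ 1 ≤ 2 ^ m := Nat.pow_le_pow_right (by norm_num) hm
    omega
  have hM2 : 2 ^ m = (2 ^ m - 1) + 1 := by omega
  have hrec : ∀ z, 2 * S (z + 1) = S z + (2 ^ m - 1) * t z := by
    intro z
    have h1 : ∑ x ∈ Finset.range (m + 1), 2 ^ x * t (z + x) = S z + 2 ^ m * t z := by
      rw [Finset.sum_range_succ, per]
    have h2 : ∑ x ∈ Finset.range (m + 1), 2 ^ x * t (z + x) = 2 * S (z + 1) + t z := by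
      rw [Finset.sum_range_succ', Finset.mul_sum]
      simp only [pow_zero, one_mul, add_zero]
      congr 1
      refine Finset.sum_congr rfl fun x _ => ?_
      rw [pow_succ, show z + (x + 1) = z + 1 + x by ring]
      ring
    have h3 : 2 ^ m * t z = (2 ^ m - 1) * t z + t z := by
      nth_rewrite 1 [hM2]; ring
    omega
  have hcop : Nat.Coprime (2 ^ m - 1) 2 := by
    rw [Nat.coprime_two_right]
    have : Even (2 ^ m) := Nat.even_pow.mpr ⟨by norm_num, by omega⟩
    obtain ⟨a, ha⟩ := this
    exact ⟨a - 1, by omega⟩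
  have hdv : ∀ z, 2 ^ m - 1 ∣ S z := by
    intro z
    induction z with
    | zero => simpa [S] using hdiv
    | succ z ih =>
      apply hcop.dvd_of_dvd_mul_left
      rw [hrec]
      exact dvd_add ih (Dvd.intro _ rfl)
  have hSpos : ∀ z, 0 < S z := by
    have hper : ∀ k z, t (z + k * m) = t z := by
      intro k z
      induction k with
      | zero => simp
      | succ k ih => rw [show z + (k + 1) * m = z + k * m + m by ring, per, ih]
    have hmod : ∀ z, t (z % m) = t z := by
      intro z
      conv_rhs => rw [← Nat.mod_add_div z m, mul_comm m, hper]
    intro z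
    obtain ⟨z0, hz0⟩ := hpos
    by_contra hS
    have hS0 : S z = 0 := by omega
    have hall := Finset.sum_eq_zero_iff.mp hS0
    -- choose x < m with z + x ≡ z0
    have hx := hall ((z0 + (m - 1) * z) % m) (Finset.mem_range.mpr (Nat.mod_lt _ (by omega)))
    have h1 : t (z + (z0 + (m - 1) * z) % m) = t z0 := by
      rw [← hmod, ← hmod z0]
      congr 1
      rw [Nat.add_mod_mod]
      have : z + (z0 + (m - 1) * z) = z0 + m * z := by
        obtain ⟨k, rfl⟩ : ∃ k, m = k + 1 := ⟨m - 1, by omega⟩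
        simp; ring
      rw [this, Nat.add_mul_mod_self_left]
    rw [h1] at hx
    rcases Nat.mul_eq_zero.mp hx with h | h
    · exact absurd h (by positivity)
    · exact hz0 h
  have hSle : ∀ z, S z ≤ 3 * (2 ^ m - 1) := by
    intro z
    rw [← sum_two_pow_range, Finset.mul_sum]
    refine Finset.sum_le_sum fun x _ => ?_
    rw [mul_comm]
    exact Nat.mul_le_mul_right _ (hb _)
  choose τ hτ using hdv
  refine ⟨τ, fun z => ?_, fun z => ⟨?_, ?_⟩⟩
  · have h := hrec z
    rw [hτ (z + 1), hτ z] at h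
    have h' : (2 ^ m - 1) * (2 * τ (z + 1)) = (2 ^ m - 1) * (τ z + t z) := by
      rw [mul_add, ← h]; ring
    exact Nat.eq_of_mul_eq_mul_left hM h'
  · have := hSpos z
    rw [hτ z] at this
    exact Nat.pos_of_mul_pos_left this
  · have := hSle z
    rw [hτ z, mul_comm] at this
    exact Nat.le_of_mul_le_mul_right this hM

lemma anchor {t τ : ℕ → ℕ} (h : ∀ z, 2 * τ (z + 1) = τ z + t z) (hb : ∀ z, 1 ≤ τ z ∧ τ z ≤ 3)
    {q p : ℕ} (hqp : q < p) (ht : ∀ z, q ≤ z → z < p → t z ≤ 2) (hp : t p ≤ 1) :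
    τ (p + 1) = 1 := by
  have h2 : ∀ d, q + 1 + d ≤ p → τ (q + 1 + d) ≤ 2 := by
    intro d
    induction d with
    | zero =>
      intro _
      have h1 := h q
      have h3 := ht q le_rfl hqp
      have h4 := hb q
      simp only [add_zero]
      omega
    | succ d ih =>
      intro hd
      have h1 := h (q + 1 + d)
      have h3 := ht (q + 1 + d) (by omega) (by omega)
      have h4 := ih (by omega)
      rw [← add_assoc]
      omega
  have h3 := h2 (p - (q + 1)) (by omega)
  rw [show q + 1 + (p - (q + 1)) = p by omega] at h3
  have h1 := h p
  have h5 := hb (p + 1)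
  omega

lemma advance {t τ : ℕ → ℕ} (h : ∀ z, 2 * τ (z + 1) = τ z + t z) (hb : ∀ z, 1 ≤ τ z ∧ τ z ≤ 3)
    {a b : ℕ} (ha : τ a = 1) (ht : ∀ z, a ≤ z → z < b → t z ≤ 2) :
    ∀ z, a ≤ z → z < b → t z = 1 := by
  have h2 : ∀ d, a + d < b → τ (a + d) = 1 ∧ t (a + d) = 1 := by
    intro d
    induction d with
    | zero =>
      intro hd
      have h1 := h a
      have h3 := ht a le_rfl (by omega)
      have h4 := hb (a + 1)
      simp only [add_zero]
      omega
    | succ d ih =>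
      intro hd
      have h0 := ih (by omega)
      have h1 := h (a + d)
      have h1' := h (a + d + 1)
      have h3 := ht (a + d + 1) (by omega) (by omega)
      have h4 := hb (a + d + 1 + 1)
      rw [← add_assoc]
      omega
  intro z hz hzb
  have := h2 (z - a) (by omega)
  rw [show a + (z - a) = z by omega] at this
  exact this.2

lemma delta_zero {m κ : ℕ} (hm : κ + 1 ≤ m) (I : Finset ℕ) (pos δ : ℕ → ℕ)
    (hinj : Set.InjOn pos I) (hpos : ∀ i ∈ I, pos i < m) (hδ : ∀ i ∈ I, δ i ≤ 2 ^ κ)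
    (hz : ∀ i ∈ I, pos i ≤ κ → δ i = 0) (hdiv : 2 ^ m - 1 ∣ ∑ i ∈ I, 2 ^ pos i * δ i) :
    ∀ i ∈ I, δ i = 0 := by
  classical
  have hcop : Nat.Coprime (2 ^ m - 1) 2 := by
    rw [Nat.coprime_two_right]
    have : Even (2 ^ m) := Nat.even_pow.mpr ⟨by norm_num, by omega⟩
    obtain ⟨a, ha⟩ := this
    have : 2 ^ 1 ≤ 2 ^ m := Nat.pow_le_pow_right (by norm_num) (by omega)
    exact ⟨a - 1, by omega⟩
  set I' := I.filter (fun i => κ < pos i) with hI'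
  have h1 : ∑ i ∈ I, 2 ^ pos i * δ i = 2 ^ (κ + 1) * ∑ i ∈ I', 2 ^ (pos i - (κ + 1)) * δ i := by
    rw [← Finset.sum_subset (Finset.filter_subset (fun i => κ < pos i) I), Finset.mul_sum]
    · refine Finset.sum_congr rfl fun i hi => ?_
      have := (Finset.mem_filter.mp hi).2
      rw [← mul_assoc, ← pow_add, Nat.add_sub_cancel' this]
    · intro i hi hi'
      rw [hz i hi, mul_zero]
      by_contra hc
      exact hi' (Finset.mem_filter.mpr ⟨hi, by omega⟩)
  rw [h1] at hdiv
  have h2 := (Nat.Coprime.pow_right (κ + 1) hcop).dvd_of_dvd_mul_left hdiv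
  have h3 : ∑ i ∈ I', 2 ^ (pos i - (κ + 1)) * δ i < 2 ^ m - 1 := by
    calc ∑ i ∈ I', 2 ^ (pos i - (κ + 1)) * δ i ≤ ∑ i ∈ I', 2 ^ (pos i - (κ + 1)) * 2 ^ κ :=
          Finset.sum_le_sum fun i hi => Nat.mul_le_mul_left _ (hδ i (Finset.mem_filter.mp hi).1)
      _ = (∑ i ∈ I', 2 ^ (pos i - (κ + 1))) * 2 ^ κ := by rw [Finset.sum_mul]
      _ = (∑ j ∈ I'.image (fun i => pos i - (κ + 1)), 2 ^ j) * 2 ^ κ := by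
          rw [Finset.sum_image]
          intro i hi j hj hij
          have hi1 := Finset.mem_filter.mp hi
          have hj1 := Finset.mem_filter.mp hj
          apply hinj hi1.1 hj1.1
          simp only at hij
          omega
      _ ≤ (∑ j ∈ Finset.range (m - (κ + 1)), 2 ^ j) * 2 ^ κ := by
          apply Nat.mul_le_mul_right
          apply Finset.sum_le_sum_of_subset
          intro j hj
          obtain ⟨i, hi, rfl⟩ := Finset.mem_image.mp hj
          have hi1 := Finset.mem_filter.mp hi
          have := hpos i hi1.1
          rw [Finset.mem_range]
          omega
      _ = (2 ^ (m - (κ + 1)) - 1) * 2 ^ κ := by rw [sum_two_pow_range]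
      _ < 2 ^ m - 1 := by
          have e1 : 2 ^ m = 2 * (2 ^ (m - (κ + 1)) * 2 ^ κ) := by
            rw [← pow_add, ← pow_succ']; congr 1; omega
          have e2 : 1 ≤ 2 ^ κ := Nat.one_le_two_pow
          have e3 : 1 ≤ 2 ^ (m - (κ + 1)) := Nat.one_le_two_pow
          have e4 : 1 * 2 ^ κ ≤ 2 ^ (m - (κ + 1)) * 2 ^ κ := Nat.mul_le_mul_right _ e3
          rw [Nat.sub_mul, e1]
          omega
  have h4 := Nat.eq_zero_of_dvd_of_lt h2 h3
  intro i hi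
  by_cases hk : pos i ≤ κ
  · exact hz i hi hk
  · have := Finset.sum_eq_zero_iff.mp h4 i (Finset.mem_filter.mpr ⟨hi, by omega⟩)
    rcases Nat.mul_eq_zero.mp this with h | h
    · exact absurd h (by positivity)
    · exact h

lemma key_idx {K : Type*} [Field K] [Fintype K] [CharP K 2] {m : ℕ}
    (hc : Fintype.card K = 2 ^ m)
    {f : K[X]} (hf : IsOPoly K f) {I L : Finset ℕ} (pos : ℕ → ℕ) (hpos : ∀ i ∈ I, pos i < m)
    (hinj : Set.InjOn pos I)
    (hL : L ⊆ Finset.range m) (hdis : ∀ i ∈ I, pos i ∉ L) (hAn : I.Nonempty)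
    (hne : ∃ z < m, ∀ i ∈ I, pos i ≠ z) (e : ℕ → ℕ) (he : ∀ i ∈ I, e i ∈ f.support)
    (hdiv : 2 ^ m - 1 ∣ ∑ i ∈ I, 2 ^ pos i * e i + ∑ i ∈ L, 2 ^ i)
    (huniq : ∀ e' : ℕ → ℕ, (∀ i ∈ I, e' i ∈ f.support) →
      2 ^ m - 1 ∣ ∑ i ∈ I, 2 ^ pos i * e' i + ∑ i ∈ L, 2 ^ i → ∀ i ∈ I, e' i = e i) : False := by
  classical
  let E : ℕ → ℕ := fun a => if h : ∃ i ∈ I, pos i = a then e h.choose else 0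
  have hE : ∀ i ∈ I, E (pos i) = e i := by
    intro i hi
    have h : ∃ j ∈ I, pos j = pos i := ⟨i, hi, rfl⟩
    simp only [E, dif_pos h]
    congr 1
    exact hinj h.choose_spec.1 hi h.choose_spec.2
  have hsum : ∀ g : ℕ → ℕ, ∑ a ∈ I.image pos, 2 ^ a * g a = ∑ i ∈ I, 2 ^ pos i * g (pos i) := by
    intro g
    rw [Finset.sum_image hinj]
  refine key_unique hc hf (A := I.image pos) (L := L) ?_ hL ?_ (hAn.image pos) ?_ E ?_ ?_ ?_
  · intro a ha
    obtain ⟨i, hi, rfl⟩ := Finset.mem_image.mp ha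
    exact Finset.mem_range.mpr (hpos i hi)
  · rw [Finset.disjoint_left]
    intro a ha
    obtain ⟨i, hi, rfl⟩ := Finset.mem_image.mp ha
    exact hdis i hi
  · intro h
    obtain ⟨z, hz, hz'⟩ := hne
    have : z ∈ I.image pos := by rw [h]; exact Finset.mem_range.mpr hz
    obtain ⟨i, hi, hiz⟩ := Finset.mem_image.mp this
    exact hz' i hi hiz
  · intro a ha
    obtain ⟨i, hi, rfl⟩ := Finset.mem_image.mp ha
    rw [hE i hi]; exact he i hi
  · rw [hsum, Finset.sum_congr rfl (fun i hi => by rw [hE i hi])]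
    exact hdiv
  · intro e' he' hd a ha
    obtain ⟨i, hi, rfl⟩ := Finset.mem_image.mp ha
    rw [hsum] at hd
    rw [hE i hi]
    exact huniq (fun i => e' (pos i)) (fun i hi => he' _ (Finset.mem_image_of_mem _ hi)) hd i hi

end OPolyAux

namespace OPolyAux

/-! ### Walks around the cycle -/

structure Walk (E : Finset ℕ) (κ D m : ℕ) where
  s : ℕ → ℕ
  p : ℕ → ℕ
  eo : ℕ → ℕ
  K : ℕ
  I0 : ℕ
  hE0 : 0 ∉ E
  hEle : ∀ e ∈ E, e ≤ 2 ^ κ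
  hEbit : ∀ e ∈ E, ∀ b, e.testBit b = true → D ∣ b ∧ 1 ≤ b
  hD : 0 < D
  hDκ : D < κ
  hp0 : p 0 = 0
  hps : ∀ i, p (i + 1) = p i + s i
  heo : ∀ i, eo i ∈ E
  hes : ∀ i, (eo i).testBit (s i) = true
  hemax : ∀ i, ∀ e ∈ E, e.testBit (s i) = true → e ≤ eo i
  hmv : ∀ i, s i < κ → i < I0 ∧ 2 ≤ i ∧ s (i + 1) = κ ∧ s (i - 1) = κ ∧ s (i - 2) = κ
  hpK : p K = Nat.lcm D m
  hI0 : p I0 + 6 * κ ≤ m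

lemma two_pow_mod (m a : ℕ) : 2 ^ a ≡ 2 ^ (a % m) [MOD 2 ^ m - 1] := by
  conv_lhs => rw [← Nat.mod_add_div a m, pow_add, pow_mul]
  have h : 2 ^ m ≡ 1 [MOD 2 ^ m - 1] := by
    have : 1 ≤ 2 ^ m := Nat.one_le_two_pow
    exact ((Nat.modEq_iff_dvd' this).mpr dvd_rfl).symm
  simpa using (Nat.ModEq.refl (2 ^ (a % m))).mul (h.pow (a / m))

/-- pairs (index, bit) -/
def prs (K : ℕ) (e : ℕ → ℕ) : Finset (Σ _ : ℕ, ℕ) :=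
  (Finset.range K).sigma (fun i => (e i).bitIndices.toFinset)

/-- number of pairs landing on the residue of z -/
def cnt (K m : ℕ) (p e : ℕ → ℕ) (z : ℕ) : ℕ :=
  ((prs K e).filter (fun x => (p x.1 + x.2) % m = z % m)).card

lemma mem_prs {K : ℕ} {e : ℕ → ℕ} {x : Σ _ : ℕ, ℕ} :
    x ∈ prs K e ↔ x.1 < K ∧ (e x.1).testBit x.2 = true := by
  simp [prs]

lemma cnt_per (K m : ℕ) (p e : ℕ → ℕ) (z : ℕ) : cnt K m p e (z + m) = cnt K m p e z := by
  simp [cnt]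

lemma cnt_mod (K m : ℕ) (p e : ℕ → ℕ) (z : ℕ) : cnt K m p e (z % m) = cnt K m p e z := by
  simp [cnt]

lemma cnt_sum {K m : ℕ} (hm : 0 < m) (p e : ℕ → ℕ) :
    ∑ i ∈ Finset.range K, 2 ^ (p i % m) * e i ≡ ∑ z ∈ Finset.range m, 2 ^ z * cnt K m p e z
      [MOD 2 ^ m - 1] := by
  classical
  have h1 : ∑ i ∈ Finset.range K, 2 ^ (p i % m) * e i
      = ∑ x ∈ prs K e, 2 ^ (p x.1 % m + x.2) := by
    rw [prs, Finset.sum_sigma]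
    refine Finset.sum_congr rfl fun i _ => ?_
    conv_lhs => rw [← sum_bits (e i), Finset.mul_sum]
    refine Finset.sum_congr rfl fun b _ => ?_
    rw [pow_add]
  have h2 : ∑ z ∈ Finset.range m, 2 ^ z * cnt K m p e z
      = ∑ x ∈ prs K e, 2 ^ ((p x.1 + x.2) % m) := by
    rw [← Finset.sum_fiberwise_of_maps_to (s := prs K e) (t := Finset.range m)
      (g := fun x => (p x.1 + x.2) % m)
      (fun x _ => Finset.mem_range.mpr (Nat.mod_lt _ hm))]
    refine Finset.sum_congr rfl fun z hz => ?_
    rw [Finset.sum_congr rfl (g := fun _ => 2 ^ z)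
      (fun x hx => by rw [(Finset.mem_filter.mp hx).2])]
    rw [Finset.sum_const, smul_eq_mul, mul_comm, cnt, Nat.mod_eq_of_lt (Finset.mem_range.mp hz)]
  rw [h1, h2]
  have h3 : ∀ x ∈ prs K e, 2 ^ (p x.1 % m + x.2) ≡ 2 ^ ((p x.1 + x.2) % m) [MOD 2 ^ m - 1] := by
    intro x _
    have := two_pow_mod m (p x.1 % m + x.2)
    rwa [Nat.mod_add_mod] at this
  exact Nat.ModEq.sum h3

namespace Walk

variable {E : Finset ℕ} {κ D m : ℕ}

lemma s_le (W : Walk E κ D m) (i : ℕ) : W.s i ≤ κ := by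
  have h1 := Nat.ge_two_pow_of_testBit (W.hes i)
  exact (Nat.pow_le_pow_iff_right (by norm_num : 1 < 2)).mp (h1.trans (W.hEle _ (W.heo i)))

lemma s_pos (W : Walk E κ D m) (i : ℕ) : 1 ≤ W.s i := (W.hEbit _ (W.heo i) _ (W.hes i)).2

lemma s_dvd (W : Walk E κ D m) (i : ℕ) : D ∣ W.s i := (W.hEbit _ (W.heo i) _ (W.hes i)).1

lemma p_dvd (W : Walk E κ D m) (i : ℕ) : D ∣ W.p i := by
  induction i with
  | zero => rw [W.hp0]; exact dvd_zero _
  | succ i ih => rw [W.hps]; exact dvd_add ih (W.s_dvd i)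

lemma p_strict (W : Walk E κ D m) : StrictMono W.p := by
  apply strictMono_nat_of_lt_succ
  intro i
  have := W.s_pos i
  rw [W.hps]; omega

lemma s_zero (W : Walk E κ D m) : W.s 0 = κ := by
  by_contra h
  have h1 := W.s_le 0
  have := W.hmv 0 (by omega)
  omega

lemma dvd_kap (W : Walk E κ D m) : D ∣ κ := by
  have := W.s_dvd 0
  rwa [W.s_zero] at this

lemma m_le (W : Walk E κ D m) (hm : 0 < m) : m ≤ Nat.lcm D m :=
  Nat.le_of_dvd (Nat.lcm_pos W.hD hm) (Nat.dvd_lcm_right _ _)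

lemma kap_pos (W : Walk E κ D m) : 0 < κ := lt_trans W.hD W.hDκ

lemma m_pos (W : Walk E κ D m) : 6 * κ ≤ m := by
  have h1 := W.hI0
  omega

lemma I0_lt (W : Walk E κ D m) : W.I0 < W.K := by
  have h1 := W.hI0
  have h2 := W.kap_pos
  have h3 := W.m_le (by omega)
  rw [← W.hpK] at h3
  exact W.p_strict.lt_iff_lt.mp (by omega)

lemma s_big (W : Walk E κ D m) {i : ℕ} (h : W.I0 ≤ i) : W.s i = κ := by
  by_contra hc
  have h1 := W.s_le i
  have := W.hmv i (by omega)
  omega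

lemma p_two (W : Walk E κ D m) (i : ℕ) : W.p i + κ ≤ W.p (i + 2) := by
  have h1 := W.hps i
  have h2 := W.hps (i + 1)
  by_cases h : W.s i = κ
  · rw [show i + 2 = i + 1 + 1 by ring]; omega
  · have h3 := W.s_le i
    have := W.hmv i (by omega)
    rw [show i + 2 = i + 1 + 1 by ring]; omega

lemma p_le (W : Walk E κ D m) {i : ℕ} (h : i < W.K) : W.p i + κ ≤ Nat.lcm D m := by
  rw [← W.hpK]
  by_cases h1 : W.s i = κ
  · have := W.p_strict.monotone (show i + 1 ≤ W.K by omega)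
    rw [W.hps] at this
    omega
  · have h3 := W.s_le i
    have h4 := (W.hmv i (by omega)).1
    have h5 := W.I0_lt
    have := W.p_strict.monotone (show i + 2 ≤ W.K by omega)
    have := W.p_two i
    omega

lemma lift (W : Walk E κ D m) {x y : ℕ} (hx : D ∣ x) (hy : D ∣ y) (hx0 : 0 < x) (hy0 : 0 < y)
    (hxl : x ≤ Nat.lcm D m) (hyl : y ≤ Nat.lcm D m) (h : x % m = y % m) : x = y := by
  have key : ∀ x y : ℕ, D ∣ x → D ∣ y → 0 < x → y ≤ Nat.lcm D m → x % m = y % m → x ≤ y →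
      x = y := by
    intro x y hx hy hx0 hyl h hxy
    have h1 : m ∣ y - x := (Nat.modEq_iff_dvd' hxy).mp h
    have h2 : D ∣ y - x := Nat.dvd_sub hy hx
    have h3 := Nat.eq_zero_of_dvd_of_lt (Nat.lcm_dvd h2 h1) (by omega)
    omega
  rcases le_total x y with h1 | h1
  · exact key x y hx hy hx0 hyl h h1
  · exact (key y x hy hx hy0 hxl h.symm h1).symm

/-- data of a bit of a member of `E` -/
lemma bit_bd (W : Walk E κ D m) {e b : ℕ} (he : e ∈ E) (hb : e.testBit b = true) :
    D ∣ b ∧ 1 ≤ b ∧ b ≤ κ := by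
  refine ⟨(W.hEbit e he b hb).1, (W.hEbit e he b hb).2, ?_⟩
  have h1 := Nat.ge_two_pow_of_testBit hb
  exact (Nat.pow_le_pow_iff_right (by norm_num : 1 < 2)).mp (h1.trans (W.hEle _ he))

lemma eq_top (W : Walk E κ D m) {e : ℕ} (he : e ∈ E) (hb : e.testBit κ = true) : e = 2 ^ κ :=
  le_antisymm (W.hEle e he) (Nat.ge_two_pow_of_testBit hb)

lemma lift_pair (W : Walk E κ D m) {i j b b' : ℕ} (hi : i < W.K) (hj : j < W.K)
    (hb : D ∣ b ∧ 1 ≤ b ∧ b ≤ κ) (hb' : D ∣ b' ∧ 1 ≤ b' ∧ b' ≤ κ)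
    (h : (W.p i + b) % m = (W.p j + b') % m) : W.p i + b = W.p j + b' := by
  have h1 := W.p_le hi
  have h2 := W.p_le hj
  exact W.lift (dvd_add (W.p_dvd i) hb.1) (dvd_add (W.p_dvd j) hb'.1) (by omega) (by omega)
    (by omega) (by omega) h

lemma conflict (W : Walk E κ D m) {i j b b' : ℕ} (hij : i < j) (hb : b ≤ κ) (hb' : 1 ≤ b')
    (h : W.p i + b = W.p j + b') : j = i + 1 ∧ W.s i < κ ∧ W.s j = κ ∧ b' < κ := by
  have h0 : j = i + 1 := by
    by_contra hc
    have h1 := W.p_strict.monotone (show i + 2 ≤ j by omega)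
    have h2 := W.p_two i
    omega
  subst h0
  have h3 := W.hps i
  have h4 : W.s i < κ := by omega
  have h5 := W.hmv i h4
  have h6 := W.s_pos i
  exact ⟨rfl, h4, h5.2.2.1, by omega⟩

lemma cnt_le_two (W : Walk E κ D m) {e : ℕ → ℕ} (he : ∀ i, i < W.K → e i ∈ E) (z : ℕ) :
    cnt W.K m W.p e z ≤ 2 := by
  by_contra hc
  rw [not_le, cnt, Finset.two_lt_card] at hc
  obtain ⟨⟨i, a⟩, hi, ⟨j, b⟩, hj, ⟨k, c⟩, hk, h1, h2, h3⟩ := hc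
  rw [Finset.mem_filter, mem_prs] at hi hj hk
  obtain ⟨⟨hi, ha⟩, hiz⟩ := hi
  obtain ⟨⟨hj, hb⟩, hjz⟩ := hj
  obtain ⟨⟨hk, hc⟩, hkz⟩ := hk
  simp only at hi ha hiz hj hb hjz hk hc hkz
  have ha' := W.bit_bd (he i hi) ha
  have hb' := W.bit_bd (he j hj) hb
  have hc' := W.bit_bd (he k hk) hc
  have e1 := W.lift_pair hi hj ha' hb' (hiz.trans hjz.symm)
  have e2 := W.lift_pair hi hk ha' hc' (hiz.trans hkz.symm)
  have n1 : i ≠ j := by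
    rintro rfl
    exact h1 (by rw [show a = b by omega])
  have n2 : i ≠ k := by
    rintro rfl
    exact h2 (by rw [show a = c by omega])
  have n3 : j ≠ k := by
    rintro rfl
    exact h3 (by rw [show b = c by omega])
  have q : ∀ {i j b b' : ℕ}, i ≠ j → (1 ≤ b ∧ b ≤ κ) → (1 ≤ b' ∧ b' ≤ κ) →
      W.p i + b = W.p j + b' → j = i + 1 ∨ i = j + 1 := by
    intro i j b b' hij hb hb' h
    rcases Nat.lt_or_gt_of_ne hij with h' | h'
    · exact Or.inl (W.conflict h' hb.2 hb'.1 h).1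
    · exact Or.inr (W.conflict h' hb'.2 hb.1 h.symm).1
  have r1 := q n1 ha'.2 hb'.2 e1
  have r2 := q n2 ha'.2 hc'.2 e2
  have r3 := q n3 hb'.2 hc'.2 (e1.symm.trans e2)
  omega

/-- a residue is pure if no move window covers it -/
lemma cnt_le_one (W : Walk E κ D m) {e : ℕ → ℕ} (he : ∀ i, i < W.K → e i ∈ E) (z : ℕ)
    (hp : ∀ i, W.s i < κ → ∀ y, W.p i + W.s i < y → y ≤ W.p i + κ → y % m ≠ z % m) :
    cnt W.K m W.p e z ≤ 1 := by
  by_contra hc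
  rw [not_le, cnt, Finset.one_lt_card] at hc
  obtain ⟨⟨i, a⟩, hi, ⟨j, b⟩, hj, h1⟩ := hc
  rw [Finset.mem_filter, mem_prs] at hi hj
  obtain ⟨⟨hi, ha⟩, hiz⟩ := hi
  obtain ⟨⟨hj, hb⟩, hjz⟩ := hj
  simp only at hi ha hiz hj hb hjz
  have ha' := W.bit_bd (he i hi) ha
  have hb' := W.bit_bd (he j hj) hb
  have e1 := W.lift_pair hi hj ha' hb' (hiz.trans hjz.symm)
  have n1 : i ≠ j := by
    rintro rfl
    exact h1 (by rw [show a = b by omega])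
  rcases Nat.lt_or_gt_of_ne n1 with h' | h'
  · obtain ⟨rfl, h3, -⟩ := W.conflict h' ha'.2.2 hb'.2.1 e1
    refine hp i h3 (W.p i + a) ?_ (by omega) hiz
    have := W.hps i
    omega
  · obtain ⟨rfl, h3, -⟩ := W.conflict h' hb'.2.2 ha'.2.1 e1.symm
    refine hp j h3 (W.p j + b) ?_ (by omega) hjz
    have := W.hps j
    omega

lemma eo_top (W : Walk E κ D m) {i : ℕ} (h : W.s i = κ) : W.eo i = 2 ^ κ := by
  have := W.hes i
  rw [h] at this
  exact W.eq_top (W.heo i) this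

lemma eo_bit_top (W : Walk E κ D m) {i b : ℕ} (h : W.s i = κ) (hb : (W.eo i).testBit b = true) :
    b = κ := by
  rw [W.eo_top h, Nat.testBit_two_pow] at hb
  exact (by simpa using hb : κ = b).symm

lemma cnt_eo_le (W : Walk E κ D m) (z : ℕ) : cnt W.K m W.p W.eo z ≤ 1 := by
  by_contra hc
  rw [not_le, cnt, Finset.one_lt_card] at hc
  obtain ⟨⟨i, a⟩, hi, ⟨j, b⟩, hj, h1⟩ := hc
  rw [Finset.mem_filter, mem_prs] at hi hj
  obtain ⟨⟨hi, ha⟩, hiz⟩ := hi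
  obtain ⟨⟨hj, hb⟩, hjz⟩ := hj
  simp only at hi ha hiz hj hb hjz
  have ha' := W.bit_bd (W.heo i) ha
  have hb' := W.bit_bd (W.heo j) hb
  have e1 := W.lift_pair hi hj ha' hb' (hiz.trans hjz.symm)
  have n1 : i ≠ j := by
    rintro rfl
    exact h1 (by rw [show a = b by omega])
  rcases Nat.lt_or_gt_of_ne n1 with h' | h'
  · obtain ⟨-, -, h4, h5⟩ := W.conflict h' ha'.2.2 hb'.2.1 e1
    have := W.eo_bit_top h4 hb
    omega
  · obtain ⟨-, -, h4, h5⟩ := W.conflict h' hb'.2.2 ha'.2.1 e1.symm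
    have := W.eo_bit_top h4 ha
    omega

lemma covered (W : Walk E κ D m) {i : ℕ} (hi : i < W.K) : 1 ≤ cnt W.K m W.p W.eo (W.p (i + 1)) := by
  rw [cnt, Nat.one_le_iff_ne_zero, Finset.card_ne_zero]
  refine ⟨⟨i, W.s i⟩, ?_⟩
  rw [Finset.mem_filter, mem_prs]
  exact ⟨⟨hi, W.hes i⟩, by rw [W.hps]⟩

/-- free positions -/
def L (W : Walk E κ D m) : Finset ℕ := (Finset.range m).filter (fun z => cnt W.K m W.p W.eo z = 0)

lemma covered_not (W : Walk E κ D m) {i : ℕ} (hi : i < W.K) : W.p (i + 1) % m ∉ W.L := by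
  intro h
  have := (Finset.mem_filter.mp h).2
  rw [cnt_mod] at this
  have := W.covered hi
  omega

lemma p_not (W : Walk E κ D m) {i : ℕ} (hi : i < W.K) : W.p i % m ∉ W.L := by
  rcases i with _ | i
  · have h := W.covered_not (i := W.K - 1) (by omega)
    rw [show W.K - 1 + 1 = W.K by omega, W.hpK] at h
    rw [W.hp0]
    rwa [Nat.mod_eq_zero_of_dvd (Nat.dvd_lcm_right _ _), ← Nat.zero_mod m] at h
  · exact W.covered_not (by omega)

lemma sum_L (W : Walk E κ D m) (hm : 0 < m) (e : ℕ → ℕ) :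
    ∑ i ∈ Finset.range W.K, 2 ^ (W.p i % m) * e i + ∑ i ∈ W.L, 2 ^ i ≡
      ∑ z ∈ Finset.range m, 2 ^ z * (cnt W.K m W.p e z + if z % m ∈ W.L then 1 else 0)
      [MOD 2 ^ m - 1] := by
  have h1 : ∑ i ∈ W.L, 2 ^ i = ∑ z ∈ Finset.range m, 2 ^ z * (if z % m ∈ W.L then 1 else 0) := by
    rw [L, Finset.sum_filter]
    refine Finset.sum_congr rfl fun z hz => ?_
    rw [Nat.mod_eq_of_lt (Finset.mem_range.mp hz)]
    simp [Finset.mem_range.mp hz]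
  rw [h1]
  simp only [mul_add, Finset.sum_add_distrib]
  exact (cnt_sum hm _ _).add_right _

lemma div_eo (W : Walk E κ D m) (hm : 0 < m) :
    2 ^ m - 1 ∣ ∑ i ∈ Finset.range W.K, 2 ^ (W.p i % m) * W.eo i + ∑ i ∈ W.L, 2 ^ i := by
  rw [← Nat.modEq_zero_iff_dvd]
  refine (W.sum_L hm W.eo).trans ?_
  rw [Nat.modEq_zero_iff_dvd]
  rw [Finset.sum_congr rfl (g := fun z => 2 ^ z)]
  · rw [sum_two_pow_range]
  · intro z hz
    have h1 := W.cnt_eo_le z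
    rw [Nat.mod_eq_of_lt (Finset.mem_range.mp hz)]
    by_cases h : z ∈ W.L
    · have := (Finset.mem_filter.mp h).2
      simp [h, this]
    · have : cnt W.K m W.p W.eo z ≠ 0 := fun h0 => h (Finset.mem_filter.mpr ⟨hz, h0⟩)
      rw [if_neg h, show cnt W.K m W.p W.eo z = 1 by omega]; simp

lemma bit_of_cnt (W : Walk E κ D m) {e : ℕ → ℕ} (he : ∀ i, i < W.K → e i ∈ E) {i : ℕ}
    (hi : i < W.K) (h : cnt W.K m W.p e (W.p (i + 1)) ≠ 0) : (e i).testBit (W.s i) = true := by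
  rw [cnt, Finset.card_ne_zero] at h
  obtain ⟨⟨j, b⟩, hj⟩ := h
  rw [Finset.mem_filter, mem_prs] at hj
  obtain ⟨⟨hj, hb⟩, hjz⟩ := hj
  simp only at hj hb hjz
  have hb' := W.bit_bd (he j hj) hb
  rw [W.hps] at hjz
  have hs : D ∣ W.s i ∧ 1 ≤ W.s i ∧ W.s i ≤ κ := ⟨W.s_dvd i, W.s_pos i, W.s_le i⟩
  have e1 := W.lift_pair hj hi hb' hs hjz
  have hji : j = i := by
    by_contra hne
    rcases Nat.lt_or_gt_of_ne hne with h' | h'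
    · obtain ⟨-, -, h4, h5⟩ := W.conflict h' hb'.2.2 hs.2.1 e1
      omega
    · have := W.p_strict.monotone (show i + 1 ≤ j by omega)
      rw [W.hps] at this
      omega
  subst hji
  rwa [show W.s j = b by omega]

lemma unique (W : Walk E κ D m) {e : ℕ → ℕ} (he : ∀ i, i < W.K → e i ∈ E)
    (hdiv : 2 ^ m - 1 ∣ ∑ i ∈ Finset.range W.K, 2 ^ (W.p i % m) * e i + ∑ i ∈ W.L, 2 ^ i) :
    ∀ i < W.K, e i = W.eo i := by
  have hκ := W.kap_pos
  have hm6 := W.m_pos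
  have hm : 0 < m := by omega
  have hIm := W.hI0
  have hIK := W.I0_lt
  set t : ℕ → ℕ := fun z => cnt W.K m W.p e z + if z % m ∈ W.L then 1 else 0 with ht
  have htle : ∀ z, t z ≤ 3 := by
    intro z
    have := W.cnt_le_two he z
    simp only [ht]
    split_ifs <;> omega
  have htpos : ∃ z, t z ≠ 0 := by
    have h0 : e 0 ≠ 0 := fun h => W.hE0 (h ▸ he 0 (by omega))
    obtain ⟨b, hb⟩ := Nat.exists_testBit_of_ne_zero h0
    refine ⟨W.p 0 + b, ?_⟩
    have : cnt W.K m W.p e (W.p 0 + b) ≠ 0 := by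
      rw [cnt, Finset.card_ne_zero]
      refine ⟨⟨0, b⟩, ?_⟩
      rw [Finset.mem_filter, mem_prs]
      exact ⟨⟨by simp only; omega, hb⟩, rfl⟩
    simp only [ht]
    omega
  obtain ⟨τ, hτ, hτb⟩ := carry (m := m) (by omega) t
    (fun z => by simp only [ht]; rw [cnt_per, Nat.add_mod_right]) htpos htle
    ((Nat.modEq_zero_iff_dvd).mp
      ((W.sum_L hm e).symm.trans (Nat.modEq_zero_iff_dvd.mpr hdiv)))
  -- pure positions
  have pure2 : ∀ z, (∀ i, W.s i < κ → ∀ y, W.p i + W.s i < y → y ≤ W.p i + κ → y % m ≠ z % m) →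
      t z ≤ 2 := by
    intro z hz
    have := W.cnt_le_one he z hz
    simp only [ht]
    split_ifs <;> omega
  have pure1 : ∀ z, (∀ i, W.s i < κ → ∀ y, W.p i + W.s i < y → y ≤ W.p i + κ → y % m ≠ z % m) →
      z % m ∉ W.L → t z ≤ 1 := by
    intro z hz hL
    have := W.cnt_le_one he z hz
    simp only [ht]
    rw [if_neg hL]; omega
  have cov1 : ∀ z i, i < W.K → z % m = W.p (i + 1) % m → t z = 1 → (e i).testBit (W.s i) = true := by
    intro z i hi hz h1
    apply W.bit_of_cnt he hi
    have h2 := W.covered_not hi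
    simp only [ht] at h1
    rw [hz, if_neg h2, ← cnt_mod, hz, cnt_mod] at h1
    omega
  -- windows of moves
  have mvbd : ∀ j, W.s j < κ → 2 * κ ≤ W.p j ∧ W.p j + κ < W.p (W.I0 + 1) ∧
      W.p j + κ < W.p (j + 2) := by
    intro j hj
    obtain ⟨a1, a2, a3, a4, a5⟩ := W.hmv j hj
    obtain ⟨k, rfl⟩ : ∃ k, j = k + 2 := ⟨j - 2, by omega⟩
    simp only [Nat.add_sub_cancel, show k + 2 - 1 = k + 1 by omega] at a4 a5
    have b1 := W.hps k
    have b2 : W.p (k + 2) = W.p (k + 1) + W.s (k + 1) := W.hps (k + 1)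
    have b3 : W.p (k + 2 + 1) = W.p (k + 2) + W.s (k + 2) := W.hps (k + 2)
    have b4 : W.p (k + 2 + 2) = W.p (k + 2 + 1) + W.s (k + 2 + 1) := W.hps (k + 2 + 1)
    have b5 := W.s_pos (k + 2)
    have b6 := W.p_strict.monotone (show k + 2 + 2 ≤ W.I0 + 1 by omega)
    omega
  have pI1 : W.p (W.I0 + 1) = W.p W.I0 + κ := by rw [W.hps, W.s_big le_rfl]
  have pI2 : W.p (W.I0 + 2) = W.p W.I0 + 2 * κ := by
    rw [show W.I0 + 2 = W.I0 + 1 + 1 by ring, W.hps, W.s_big (by omega), pI1]; ring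
  -- local part
  have hle : ∀ i < W.K, e i ≤ W.eo i := by
    intro i hi
    by_cases hs : W.s i = κ
    · rw [W.eo_top hs]; exact W.hEle _ (he i hi)
    have hs' : W.s i < κ := lt_of_le_of_ne (W.s_le i) hs
    obtain ⟨a1, a2, a3, a4, a5⟩ := W.hmv i hs'
    obtain ⟨k, rfl⟩ : ∃ k, i = k + 2 := ⟨i - 2, by omega⟩
    simp only [Nat.add_sub_cancel, show k + 2 - 1 = k + 1 by omega] at a4 a5
    have b2 : W.p (k + 2) = W.p (k + 1) + W.s (k + 1) := W.hps (k + 1)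
    have b3 : W.p (k + 2 + 1) = W.p (k + 2) + W.s (k + 2) := W.hps (k + 2)
    have b6 := W.p_strict.monotone (show k + 2 + 1 ≤ W.I0 by omega)
    have hpure : ∀ z, W.p (k + 1) ≤ z → z ≤ W.p (k + 2 + 1) →
        ∀ i, W.s i < κ → ∀ y, W.p i + W.s i < y → y ≤ W.p i + κ → y % m ≠ z % m := by
      intro z hz1 hz2 j hj y hy1 hy2 hyz
      have c1 := mvbd j hj
      rw [Nat.mod_eq_of_lt (show y < m by omega), Nat.mod_eq_of_lt (show z < m by omega)] at hyz
      subst hyz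
      obtain ⟨d1, d2, d3, d4, d5⟩ := W.hmv j hj
      rw [← W.hps] at hy1
      by_cases hjk : k + 2 ≤ j
      · have := W.p_strict.monotone (show k + 2 + 1 ≤ j + 1 by omega)
        omega
      · have hj1 : j ≠ k + 1 := by rintro rfl; omega
        have hj2 : j ≠ k := by rintro rfl; omega
        have := W.p_strict.monotone (show j + 2 ≤ k + 1 by omega)
        omega
    have ha := anchor hτ hτb (q := W.p (k + 1)) (p := W.p (k + 2))
      (W.p_strict (by omega)) (fun z h1 h2 => pure2 z (hpure z h1 (by omega)))
      (pure1 _ (hpure _ (by omega) (by omega)) (W.p_not hi))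
    have hs1 := W.s_pos (k + 2)
    have hb := advance hτ hτb (b := W.p (k + 2 + 1) + 1) ha
      (fun z h1 h2 => pure2 z (hpure z (by omega) (by omega))) (W.p (k + 2 + 1)) (by omega) (by omega)
    exact W.hemax _ _ (he _ hi) (cov1 _ _ hi rfl hb)
  -- tail
  have hpureT : ∀ z, W.p (W.I0 + 1) ≤ z → z ≤ m + 2 * κ →
      ∀ i, W.s i < κ → ∀ y, W.p i + W.s i < y → y ≤ W.p i + κ → y % m ≠ z % m := by
    intro z hz1 hz2 j hj y hy1 hy2 hyz
    have c1 := mvbd j hj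
    rw [Nat.mod_eq_of_lt (show y < m by omega)] at hyz
    by_cases hzm : z < m
    · rw [Nat.mod_eq_of_lt hzm] at hyz
      omega
    · rw [Nat.mod_eq_sub_mod (by omega), Nat.mod_eq_of_lt (by omega)] at hyz
      omega
  have hI1m : W.p (W.I0 + 1 + 1) = W.p (W.I0 + 2) := rfl
  have hI1K : W.I0 + 1 < W.K := by
    have h3 := W.m_le (by omega)
    rw [← W.hpK] at h3
    exact W.p_strict.lt_iff_lt.mp (by omega)
  have ha := anchor hτ hτb (q := W.p (W.I0 + 1)) (p := W.p (W.I0 + 2))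
    (W.p_strict (by omega)) (fun z h1 h2 => pure2 z (hpureT z h1 (by omega)))
    (pure1 _ (hpureT _ (by omega) (by omega)) (W.covered_not hI1K))
  have hb := advance hτ hτb (b := m + 2 * κ + 1) ha
    (fun z h1 h2 => pure2 z (hpureT z (by omega) (by omega)))
  have htail : ∀ i < W.K, W.p i % m ≤ κ → e i = W.eo i := by
    intro i hi hpi
    have hs : W.s i = κ := by
      by_contra hs
      have hs' : W.s i < κ := lt_of_le_of_ne (W.s_le i) hs
      have c1 := mvbd i hs'
      rw [Nat.mod_eq_of_lt (by omega)] at hpi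
      omega
    rw [W.eo_top hs]
    apply W.eq_top (he i hi)
    have := cov1 (m + W.p i % m + κ) i hi (by
      rw [W.hps, hs, add_assoc, Nat.add_mod_left, Nat.mod_add_mod]) (hb _ (by omega) (by omega))
    rwa [hs] at this
  have hinj : Set.InjOn (fun i => W.p i % m) (Finset.range W.K : Set ℕ) := by
    intro i hi j hj hij
    simp only [Finset.coe_range, Set.mem_Iio] at hi hj
    simp only at hij
    have hk : D ∣ κ ∧ 1 ≤ κ ∧ κ ≤ κ := ⟨W.dvd_kap, hκ, le_rfl⟩
    have := W.lift_pair hi hj hk hk (by rw [Nat.add_mod, hij, ← Nat.add_mod])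
    exact W.p_strict.injective (by omega)
  have hdz := delta_zero (m := m) (κ := κ) (by omega) (Finset.range W.K) (fun i => W.p i % m)
    (fun i => W.eo i - e i) hinj (fun i _ => Nat.mod_lt _ hm)
    (fun i _ => (Nat.sub_le _ _).trans (W.hEle _ (W.heo i)))
    (fun i hi h => by
      have := htail i (Finset.mem_range.mp hi) h
      simp [this]) (by
      have h2 := Nat.dvd_sub (W.div_eo hm) hdiv
      rw [Nat.add_sub_add_right] at h2
      have h3 : ∑ i ∈ Finset.range W.K, 2 ^ (W.p i % m) * W.eo i
          = ∑ i ∈ Finset.range W.K, 2 ^ (W.p i % m) * (W.eo i - e i)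
            + ∑ i ∈ Finset.range W.K, 2 ^ (W.p i % m) * e i := by
        rw [← Finset.sum_add_distrib]
        refine Finset.sum_congr rfl fun i hi => ?_
        rw [← mul_add, Nat.sub_add_cancel (hle i (Finset.mem_range.mp hi))]
      rw [h3, Nat.add_sub_cancel] at h2
      exact h2)
  intro i hi
  have h1 := hdz i (Finset.mem_range.mpr hi)
  have h2 := hle i hi
  replace h1 : W.eo i - e i = 0 := h1
  omega

theorem contra (W : Walk E κ D m) {K : Type*} [Field K] [Fintype K] [CharP K 2]
    (hc : Fintype.card K = 2 ^ m) {f : K[X]} (hf : IsOPoly K f) (hE : f.support = E) : False := by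
  have hκ := W.kap_pos
  have hm6 := W.m_pos
  have hm : 0 < m := by omega
  have hIK := W.I0_lt
  have hDκ := W.hDκ
  have hinj : Set.InjOn (fun i => W.p i % m) (Finset.range W.K : Set ℕ) := by
    intro i hi j hj hij
    simp only [Finset.coe_range, Set.mem_Iio] at hi hj
    simp only at hij
    have hk : D ∣ κ ∧ 1 ≤ κ ∧ κ ≤ κ := ⟨W.dvd_kap, hκ, le_rfl⟩
    have := W.lift_pair hi hj hk hk (by rw [Nat.add_mod, hij, ← Nat.add_mod])
    exact W.p_strict.injective (by omega)
  refine key_idx hc hf (I := Finset.range W.K) (L := W.L) (fun i => W.p i % m)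
    (fun i _ => Nat.mod_lt _ hm) hinj (Finset.filter_subset _ _)
    (fun i hi => W.p_not (Finset.mem_range.mp hi)) ⟨0, Finset.mem_range.mpr (by omega)⟩
    ⟨D, by omega, ?_⟩ W.eo (fun i _ => hE ▸ W.heo i) (W.div_eo hm)
    (fun e' he' hd i hi => W.unique (e := e')
      (fun i hi => hE ▸ he' i (Finset.mem_range.mpr hi)) hd i (Finset.mem_range.mp hi))
  intro i hi hiD
  have hi := Finset.mem_range.mp hi
  replace hiD : W.p i % m = D := hiD
  have hD := W.hD
  rcases Nat.eq_zero_or_pos i with rfl | hi0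
  · rw [W.hp0, Nat.zero_mod] at hiD
    omega
  · have h1 := W.p_strict.monotone (show 0 + 1 ≤ i by omega)
    rw [W.hps, W.hp0, W.s_zero] at h1
    have h2 := W.p_le hi
    have := W.lift (W.p_dvd i) dvd_rfl (by omega) W.hD (by omega) (by omega)
      (by rw [hiD, Nat.mod_eq_of_lt (by omega)])
    omega

end Walk

end OPolyAux

namespace OPolyAux

lemma step_seq {G : Set ℕ} {κ : ℕ} (hκ : κ ∈ G) (hle : ∀ g ∈ G, g ≤ κ) {x : ℕ}
    (hx : x ∈ AddSubmonoid.closure G) :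
    ∃ (s : ℕ → ℕ) (I0 : ℕ), (∀ i, s i ∈ G) ∧
      (∀ i, s i < κ → i < I0 ∧ 2 ≤ i ∧ s (i + 1) = κ ∧ s (i - 1) = κ ∧ s (i - 2) = κ) ∧
      ∑ i ∈ Finset.range I0, s i ≡ x [MOD κ] := by
  obtain ⟨l, hl, rfl⟩ := AddSubmonoid.exists_list_of_mem_closure hx
  clear hx
  induction l with
  | nil =>
    exact ⟨fun _ => κ, 0, fun _ => hκ, fun i hi => absurd hi (lt_irrefl _), by simp; rfl⟩
  | cons g l ih =>
    obtain ⟨s, I0, h1, h2, h3⟩ := ih (fun y hy => hl y (List.mem_cons_of_mem _ hy))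
    let s' : ℕ → ℕ := fun i => match i with
      | 0 => κ
      | 1 => κ
      | 2 => g
      | (i + 3) => s i
    have hs0 : s 0 = κ := by
      by_contra hc
      have := h2 0 (lt_of_le_of_ne (hle _ (h1 0)) hc)
      omega
    refine ⟨s', I0 + 3, ?_, ?_, ?_⟩
    · intro i
      match i with
      | 0 => exact hκ
      | 1 => exact hκ
      | 2 => exact hl g List.mem_cons_self
      | (i + 3) => exact h1 i
    · intro i hi
      match i, hi with
      | 0, hi => exact absurd hi (lt_irrefl _)
      | 1, hi => exact absurd hi (lt_irrefl _)
      | 2, hi => exact ⟨by omega, le_rfl, hs0, rfl, rfl⟩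
      | (i + 3), hi =>
        have h4 := h2 i hi
        obtain ⟨k, rfl⟩ : ∃ k, i = k + 2 := ⟨i - 2, by omega⟩
        exact ⟨by omega, by omega, h4.2.2.1, h4.2.2.2.1, h4.2.2.2.2⟩
    · rw [Finset.sum_range_succ', Finset.sum_range_succ', Finset.sum_range_succ']
      have : ∑ k ∈ Finset.range I0, s' (k + 1 + 1 + 1) = ∑ k ∈ Finset.range I0, s k := rfl
      rw [this]
      have e : ∑ k ∈ Finset.range I0, s k + s' (0 + 1 + 1) + s' (0 + 1) + s' 0
          = ∑ k ∈ Finset.range I0, s k + g + κ * 2 := by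
        change ∑ k ∈ Finset.range I0, s k + g + κ + κ = _
        ring
      rw [e, List.sum_cons, add_comm g]
      have h5 : κ * 2 ≡ 0 [MOD κ] := (Nat.modEq_zero_iff_dvd).mpr (Dvd.intro _ rfl)
      simpa using (h3.add_right g).add h5

theorem walk_exists (E : Finset ℕ) (κ : ℕ) (hE0 : 0 ∉ E) (hEle : ∀ e ∈ E, e ≤ 2 ^ κ)
    (htop : 2 ^ κ ∈ E) (hbit : ∀ e ∈ E, ∀ b, e.testBit b = true → 1 ≤ b)
    (hne : ∃ e ∈ E, e ≠ 2 ^ κ) :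
    ∃ m0, ∀ m ≥ m0, ∃ D, Nonempty (Walk E κ D m) := by
  classical
  let G : Set ℕ := {b | ∃ e ∈ E, e.testBit b = true}
  have hGle : ∀ g ∈ G, g ≤ κ := by
    rintro g ⟨e, he, hb⟩
    have h1 := Nat.ge_two_pow_of_testBit hb
    exact (Nat.pow_le_pow_iff_right (by norm_num : 1 < 2)).mp (h1.trans (hEle _ he))
  have hκG : κ ∈ G := ⟨_, htop, by simp [Nat.testBit_two_pow]⟩
  have hκ1 : 1 ≤ κ := hbit _ htop κ (by simp [Nat.testBit_two_pow])
  let D := Nat.setGcd G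
  have hDG : ∀ g ∈ G, D ∣ g := fun g hg => Nat.setGcd_dvd_of_mem hg
  have hD0 : 0 < D := Nat.pos_of_dvd_of_pos (hDG κ hκG) hκ1
  have hDκ : D < κ := by
    obtain ⟨e, he, hek⟩ := hne
    have h0 : e ≠ 0 := fun h => hE0 (h ▸ he)
    obtain ⟨b, hb⟩ := Nat.exists_testBit_of_ne_zero h0
    have hbG : b ∈ G := ⟨e, he, hb⟩
    have h1 := hGle b hbG
    have h2 := hbit e he b hb
    have h3 : b ≠ κ := by
      rintro rfl
      exact hek (le_antisymm (hEle e he) (Nat.ge_two_pow_of_testBit hb))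
    have := Nat.le_of_dvd h2 (hDG b hbG)
    omega
  have hmain : ∀ ρ : ℕ, ∃ (s : ℕ → ℕ) (I0 : ℕ), (∀ i, s i ∈ G) ∧
      (∀ i, s i < κ → i < I0 ∧ 2 ≤ i ∧ s (i + 1) = κ ∧ s (i - 1) = κ ∧ s (i - 2) = κ) ∧
      (D ∣ ρ → ∑ i ∈ Finset.range I0, s i ≡ ρ [MOD κ]) := by
    intro ρ
    by_cases hρ : D ∣ ρ
    · obtain ⟨N, hN⟩ := Nat.exists_mem_closure_of_ge G
      have hx : ρ + κ * N ∈ AddSubmonoid.closure G := by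
        apply hN
        · have : 1 * N ≤ κ * N := Nat.mul_le_mul_right _ hκ1
          omega
        · exact dvd_add hρ ((hDG κ hκG).mul_right _)
      obtain ⟨s, I0, h1, h2, h3⟩ := step_seq hκG hGle hx
      refine ⟨s, I0, h1, h2, fun _ => h3.trans ?_⟩
      simp [Nat.ModEq]
    · exact ⟨fun _ => κ, 0, fun _ => hκG, fun i hi => absurd hi (lt_irrefl _), fun h => absurd h hρ⟩
  choose s I0 hsG hmv hsum using hmain
  have heo : ∀ ρ i, ∃ e ∈ E, e.testBit (s ρ i) = true ∧
      ∀ e' ∈ E, e'.testBit (s ρ i) = true → e' ≤ e := by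
    intro ρ i
    obtain ⟨e0, he0, hb0⟩ := hsG ρ i
    obtain ⟨e, he, hmax⟩ := Finset.exists_max_image (E.filter (fun e => e.testBit (s ρ i) = true)) id
      ⟨e0, Finset.mem_filter.mpr ⟨he0, hb0⟩⟩
    have he := Finset.mem_filter.mp he
    exact ⟨e, he.1, he.2, fun e' h1 h2 => hmax e' (Finset.mem_filter.mpr ⟨h1, h2⟩)⟩
  choose eo heo1 heo2 heo3 using heo
  let p : ℕ → ℕ → ℕ := fun ρ i => ∑ j ∈ Finset.range i, s ρ j
  refine ⟨∑ ρ ∈ Finset.range κ, p ρ (I0 ρ) + 6 * κ, fun m hm => ⟨D, ?_⟩⟩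
  set Λ := Nat.lcm D m with hΛ
  let ρ := Λ % κ
  have hρκ : ρ < κ := Nat.mod_lt _ hκ1
  have hDρ : D ∣ ρ := (Nat.dvd_mod_iff (hDG κ hκG)).mpr (Nat.dvd_lcm_left _ _)
  have hple : p ρ (I0 ρ) + 6 * κ ≤ m := by
    have := Finset.single_le_sum (f := fun ρ => p ρ (I0 ρ)) (s := Finset.range κ)
      (fun _ _ => Nat.zero_le _) (Finset.mem_range.mpr hρκ)
    omega
  have hmΛ : m ≤ Λ := Nat.le_of_dvd (Nat.lcm_pos hD0 (by omega)) (Nat.dvd_lcm_right _ _)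
  have hsbig : ∀ i, I0 ρ ≤ i → s ρ i = κ := by
    intro i hi
    by_contra hc
    have := hmv ρ i (lt_of_le_of_ne (hGle _ (hsG ρ i)) hc)
    omega
  have hpbig : ∀ d, p ρ (I0 ρ + d) = p ρ (I0 ρ) + κ * d := by
    intro d
    induction d with
    | zero => simp
    | succ d ih =>
      have : p ρ (I0 ρ + (d + 1)) = p ρ (I0 ρ + d) + s ρ (I0 ρ + d) := Finset.sum_range_succ _ _
      rw [this, ih, hsbig _ (by omega)]
      ring
  have hdv : κ ∣ Λ - p ρ (I0 ρ) :=
    (Nat.modEq_iff_dvd' (by omega)).mp ((hsum ρ hDρ).trans (Nat.mod_modEq Λ κ))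
  obtain ⟨d, hd⟩ := hdv
  exact ⟨{ s := s ρ, p := p ρ, eo := eo ρ, K := I0 ρ + d, I0 := I0 ρ, hE0 := hE0, hEle := hEle
           hEbit := fun e he b hb => ⟨hDG b ⟨e, he, hb⟩, hbit e he b hb⟩
           hD := hD0, hDκ := hDκ, hp0 := rfl, hps := fun i => Finset.sum_range_succ _ _
           heo := heo1 ρ, hes := heo2 ρ, hemax := heo3 ρ, hmv := hmv ρ
           hpK := by rw [hpbig]; omega
           hI0 := hple }⟩

end OPolyAux

namespace OPolyAux

lemma extract {F : Type*} [Field F] [Finite F] {h : ℕ} (hh : 0 < h) {f : F[X]}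
    (hf : IsExceptionalOPoly F h f) (N : ℕ) :
    ∃ (m : ℕ) (K : Type) (_ : Field K) (_ : Fintype K) (_ : CharP K 2) (ι : F →+* K),
      N ≤ m ∧ Fintype.card K = 2 ^ m ∧ IsOPoly K (f.map ι) := by
  obtain ⟨r, ⟨hr0, ι, hι⟩, hr⟩ := hf.exists_gt N
  have hm : N ≤ h * r := by nlinarith
  haveI : Fintype (GaloisField 2 (h * r)) := Fintype.ofFinite _
  refine ⟨h * r, GaloisField 2 (h * r), inferInstance, inferInstance, inferInstance, ι, hm, ?_, hι⟩
  rw [← Nat.card_eq_fintype_card]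
  exact GaloisField.card 2 (h * r) (Nat.mul_pos hh hr0).ne'

lemma lt_two_pow_sub {n m : ℕ} (h : n + 2 ≤ m) : n < 2 ^ m - 1 := by
  have : m < 2 ^ m := Nat.lt_two_pow_self
  omega

lemma pow_case {F : Type*} [Field F] [Finite F] {f : F[X]} {κ : ℕ} (h1 : f.eval 1 = 1)
    (hs : f.support = {2 ^ κ}) : OEquiv F f (X ^ (2 ^ κ)) := by
  have hfX : f = X ^ (2 ^ κ) := by
    have h2 := f.as_sum_support_C_mul_X_pow
    rw [hs, Finset.sum_singleton] at h2
    rw [h2] at h1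
    simp only [eval_mul, eval_C, eval_pow, eval_X, one_pow, mul_one] at h1
    rw [h2, h1, map_one, one_mul]
  refine ⟨0, ?_⟩
  subst hfX
  simp

lemma six_case {F : Type*} [Field F] [Finite F] [CharP F 2] {f : F[X]} (hdeg : f.natDegree = 6)
    (h0 : 0 ∉ f.support) (hev : ∀ e ∈ f.support, Even e)
    (hrel : f.coeff 4 ^ 2 = f.coeff 2 * f.coeff 6) : OEquiv F f (X ^ 6) := by
  have h6 : f.coeff 6 ≠ 0 := by
    rw [← hdeg]
    exact leadingCoeff_ne_zero.mpr (by rintro rfl; simp at hdeg)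
  have hodd : ∀ e, ¬ Even e → f.coeff e = 0 := fun e he => by
    by_contra hc
    exact he (hev e (mem_support_iff.mpr hc))
  have hfe : f = C (f.coeff 2) * X ^ 2 + C (f.coeff 4) * X ^ 4 + C (f.coeff 6) * X ^ 6 := by
    have h2 := f.as_sum_range_C_mul_X_pow
    rw [hdeg] at h2
    simp only [Finset.sum_range_succ, Finset.sum_range_zero] at h2
    rw [hodd 1 (by decide), hodd 3 (by decide), hodd 5 (by decide),
      notMem_support_iff.mp h0] at h2
    simpa using h2
  have hsurj : Function.Surjective (fun x : F => x ^ 2) := by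
    apply Finite.surjective_of_injective
    intro x y hxy
    exact frobenius_inj F 2 (by simpa [frobenius_def] using hxy)
  obtain ⟨α, hα⟩ := hsurj (f.coeff 4 / f.coeff 6)
  simp only at hα
  have h4 : f.coeff 4 = f.coeff 6 * α ^ 2 := by rw [hα]; field_simp
  have h2 : f.coeff 2 = f.coeff 6 * α ^ 4 := by
    rw [h4] at hrel
    have : f.coeff 6 * (f.coeff 2) = f.coeff 6 * (f.coeff 6 * α ^ 4) := by
      rw [mul_comm, ← hrel]; ring
    exact mul_left_cancel₀ h6 this
  set c := f.coeff 6 with hc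
  have htwo : (2 : F) = 0 := CharTwo.two_eq_zero
  have hCtwo : (2 : F[X]) = 0 := CharTwo.two_eq_zero
  have hfe' : f = C c * (C α ^ 4 * X ^ 2 + C α ^ 2 * X ^ 4 + X ^ 6) := by
    rw [hfe, h2, h4]; simp only [map_mul, map_pow]; ring
  refine ⟨α, ?_⟩
  have e1 : f.eval (1 + α) + f.eval α = c := by
    rw [hfe']
    simp only [eval_add, eval_mul, eval_C, eval_pow, eval_X]
    linear_combination (c * (3 * α ^ 6 + 6 * α ^ 5 + 11 * α ^ 4 + 12 * α ^ 3 + 8 * α ^ 2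
      + 3 * α )) * htwo
  have e2 : f.comp (X + C α) + C (f.eval α) = C c * X ^ 6 := by
    rw [hfe']
    simp only [add_comp, mul_comp, pow_comp, C_comp, X_comp, eval_add, eval_mul, eval_C, eval_pow,
      eval_X, map_mul, map_add, map_pow]
    linear_combination (C c * (3 * C α * X ^ 5 + 8 * C α ^ 2 * X ^ 4 + 12 * C α ^ 3 * X ^ 3
      + 11 * C α ^ 4 * X ^ 2 + 6 * C α ^ 5 * X + 3 * C α ^ 6)) * hCtwo
  rw [e1, e2, ← mul_assoc, ← map_mul, inv_mul_cancel₀ h6, map_one, one_mul]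

end OPolyAux

/-- Every exceptional o-polynomial of `F_q` is equivalent to `x^6` or to
`x^(2^k)` for a positive integer `k`. -/
theorem exceptional_opoly_classification (F : Type*) [Field F] [Finite F] (h : ℕ)
    (hh : 0 < h) (hq : Nat.card F = 2 ^ h) (f : F[X])
    (hf : IsExceptionalOPoly F h f) :
    OEquiv F f (X ^ 6) ∨ ∃ k : ℕ, 0 < k ∧ OEquiv F f (X ^ (2 ^ k)) := by
  have hex := OPolyAux.extract hh hf
  have hsupp : ∀ {K : Type} [Field K] (ι : F →+* K), (f.map ι).support = f.support :=
    fun ι => support_map_of_injective f ι.injective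
  have hnat : ∀ {K : Type} [Field K] (ι : F →+* K), (f.map ι).natDegree = f.natDegree :=
    fun ι => natDegree_map ι
  haveI hchar : CharP F 2 := by
    obtain ⟨m, K, _, _, _, ι, -⟩ := hex 0
    exact (ι.charP_iff ι.injective 2).mpr inferInstance
  -- basic facts
  have hbasic : f.eval 0 = 0 ∧ f.eval 1 = 1 ∧ ∀ e ∈ f.support, Even e := by
    obtain ⟨m, K, _, _, _, ι, hm, hc, hK⟩ := hex (f.natDegree + 2)
    refine ⟨?_, ?_, ?_⟩
    · have := hK.2.2.1
      rw [← map_zero ι, eval_map_apply] at this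
      exact ι.injective this
    · have := hK.2.2.2.1
      rw [← map_one ι, eval_map_apply] at this
      exact ι.injective this
    · intro e he
      refine OPolyAux.support_even (m := m) (by omega) hc hK ?_ (hsupp ι ▸ he)
      rw [hnat]
      exact OPolyAux.lt_two_pow_sub hm
  obtain ⟨h0, h1, hev⟩ := hbasic
  have h00 : 0 ∉ f.support := by
    rw [← coeff_zero_eq_eval_zero] at h0
    simpa using h0
  have hf0 : f ≠ 0 := by
    rintro rfl
    simp at h1
  have hnmem : f.natDegree ∈ f.support := natDegree_mem_support_of_nonzero hf0
  have hn2 : 2 ≤ f.natDegree := by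
    have h3 := hev _ hnmem
    have h4 : f.natDegree ≠ 0 := fun h => h00 (h ▸ hnmem)
    obtain ⟨a, ha⟩ := h3
    omega
  by_cases hpow : ∃ κ, f.natDegree = 2 ^ κ
  · right
    obtain ⟨κ, hκ⟩ := hpow
    have hκ0 : 0 < κ := by
      rcases Nat.eq_zero_or_pos κ with rfl | h
      · rw [hκ] at hn2; norm_num at hn2
      · exact h
    refine ⟨κ, hκ0, OPolyAux.pow_case h1 ?_⟩
    by_contra hne
    have hex2 : ∃ e ∈ f.support, e ≠ 2 ^ κ := by
      by_contra hc
      push Not at hc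
      apply hne
      rw [hκ] at hnmem
      exact Finset.eq_singleton_iff_unique_mem.mpr ⟨hnmem, hc⟩
    obtain ⟨m0, hm0⟩ := OPolyAux.walk_exists f.support κ h00
      (fun e he => hκ ▸ le_natDegree_of_mem_supp e he) (hκ ▸ hnmem)
      (fun e he b hb => by
        by_contra hb0
        have hb0 : b = 0 := by omega
        subst hb0
        have := hev e he
        rw [Nat.even_iff] at this
        simp [Nat.testBit_zero, this] at hb) hex2
    obtain ⟨m, K, _, _, _, ι, hm, hc, hK⟩ := hex m0
    obtain ⟨D, ⟨W⟩⟩ := hm0 m hm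
    exact W.contra hc hK (hsupp ι)
  push Not at hpow
  have hn3 : 3 ≤ f.natDegree := by
    have := hpow 1
    omega
  by_cases h6 : f.natDegree = 6
  · left
    obtain ⟨m, K, _, _, _, ι, hm, hc, hK⟩ := hex (f.natDegree + 2)
    have hlt := OPolyAux.lt_two_pow_sub hm
    rcases Nat.even_or_odd' m with ⟨t, rfl | rfl⟩
    · exfalso
      obtain ⟨u, rfl⟩ : ∃ u, t = u + 1 := ⟨t - 1, by omega⟩
      refine OPolyAux.SS_false (by omega) hc hK (by rwa [hnat]) (by rwa [hnat]) ?_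
      rw [hnat, h6]
      exact OPolyAux.SS_six_even u
    · obtain ⟨u, rfl⟩ : ∃ u, t = u + 1 := ⟨t - 1, by omega⟩
      have hrel := OPolyAux.six_rel (t := u) hc hK (by rw [hnat, h6]) (by rw [← h6]; exact hlt)
      simp only [coeff_map, ← map_pow, ← map_mul] at hrel
      exact OPolyAux.six_case h6 h00 hev (ι.injective hrel)
  · exfalso
    obtain ⟨m0, hm0⟩ := OPolyAux.SS_large hn2 (hev _ hnmem) hpow h6
    obtain ⟨m, K, _, _, _, ι, hm, hc, hK⟩ := hex (max m0 (f.natDegree + 2))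
    have hlt := OPolyAux.lt_two_pow_sub (n := f.natDegree) (m := m) (le_trans (le_max_right _ _) hm)
    have hm2 := le_trans (le_max_right _ _) hm
    refine OPolyAux.SS_false (by omega) hc hK (by rwa [hnat]) (by rwa [hnat]) ?_
    rw [hnat]
    exact hm0 m (le_trans (le_max_left _ _) hm)
end

section
/- Let q be a power of two and let f be an o-polynomial of F_q in which the degree of every term is a power of two (i.e., every nonzero coefficient of f is the coefficient of x^{2^i} for some i). Then f is a monomial, i.e., f(x) = x^{2^k} for some k. -/
open Polynomial

lemma two_pow_add_mod (h : ℕ) [NeZero h] (z w : ZMod h) :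
    2 ^ (z.val + w.val) ≡ 2 ^ (z + w).val [MOD 2 ^ h - 1] := by
  have h1 : (2:ℕ) ^ h ≡ 1 [MOD 2 ^ h - 1] := by
    have : 1 ≤ 2 ^ h := Nat.one_le_two_pow
    have := (Nat.modEq_iff_dvd' (n := 2 ^ h - 1) this).2 dvd_rfl
    exact this.symm
  rw [ZMod.val_add]
  conv_lhs => rw [← Nat.div_add_mod (z.val + w.val) h, pow_add, pow_mul]
  simpa using (h1.pow ((z.val + w.val) / h)).mul_right (2 ^ ((z.val + w.val) % h))

lemma two_pow_sum_image (h : ℕ) [NeZero h] (J : Finset (ZMod h)) :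
    ∑ j ∈ J, 2 ^ j.val = ∑ i ∈ J.image ZMod.val, 2 ^ i := by
  rw [Finset.sum_image]
  intro a _ b _ hab
  exact ZMod.val_injective h hab

lemma two_pow_sum_univ (h : ℕ) [NeZero h] :
    ∑ j : ZMod h, 2 ^ j.val = 2 ^ h - 1 := by
  have hg : ∑ i ∈ Finset.range h, 2 ^ i = 2 ^ h - 1 := by
    simpa using Nat.geomSum_eq (le_refl 2) h
  rw [two_pow_sum_image, ← hg]
  congr 1
  ext i
  simp only [Finset.mem_image, Finset.mem_univ, true_and, Finset.mem_range]
  constructor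
  · rintro ⟨a, rfl⟩; exact ZMod.val_lt a
  · intro hi; exact ⟨i, ZMod.val_cast_of_lt hi⟩

lemma two_pow_sum_lt (h : ℕ) [NeZero h] (J : Finset (ZMod h)) (hJ : J ≠ Finset.univ) :
    ∑ j ∈ J, 2 ^ j.val < 2 ^ h - 1 := by
  rw [← two_pow_sum_univ h]
  obtain ⟨i, hi⟩ : ∃ i, i ∉ J := by
    by_contra hc
    push Not at hc
    exact hJ (Finset.eq_univ_iff_forall.2 hc)
  exact Finset.sum_lt_sum_of_subset (Finset.subset_univ J) (Finset.mem_univ i) hi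
    (by positivity) (fun _ _ _ => by positivity)

lemma binary_unique (h : ℕ) [NeZero h] (J : Finset (ZMod h)) (hne : J.Nonempty)
    (hJ : J ≠ Finset.univ) : ∀ (n : ℕ) (M : Multiset (ZMod h)), Multiset.card M = n →
    n ≤ J.card →
    (M.map (fun j => 2 ^ j.val)).sum ≡ ∑ j ∈ J, 2 ^ j.val [MOD 2 ^ h - 1] → M = J.val := by
  intro n
  induction n using Nat.strong_induction_on with
  | _ n ih =>
  intro M hM hn hmod
  by_cases hd : M.Nodup
  · set K : Finset (ZMod h) := ⟨M, hd⟩ with hK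
    have e : (M.map (fun j => 2 ^ j.val)).sum = ∑ j ∈ K, 2 ^ j.val := rfl
    rw [e] at hmod
    have hlt := two_pow_sum_lt h J hJ
    have hpos : 0 < ∑ j ∈ J, 2 ^ j.val := Finset.sum_pos (fun _ _ => by positivity) hne
    have hKJ : ∑ j ∈ K, 2 ^ j.val = ∑ j ∈ J, 2 ^ j.val := by
      by_cases hKu : K = Finset.univ
      · rw [hKu, two_pow_sum_univ] at hmod
        have : 0 ≡ ∑ j ∈ J, 2 ^ j.val [MOD 2 ^ h - 1] := by
          refine Nat.ModEq.trans ?_ hmod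
          exact (Nat.modEq_zero_iff_dvd.2 dvd_rfl).symm
        have := Nat.ModEq.eq_of_lt_of_lt this (by omega) hlt
        omega
      · exact Nat.ModEq.eq_of_lt_of_lt hmod (two_pow_sum_lt h K hKu) hlt
    rw [two_pow_sum_image, two_pow_sum_image] at hKJ
    have := Finset.geomSum_injective (le_refl 2) hKJ
    have := Finset.image_injective (ZMod.val_injective h) this
    rw [← this]
  · exfalso
    rw [Multiset.nodup_iff_ne_cons_cons] at hd
    push Not at hd
    obtain ⟨m, M', hMM⟩ := hd
    have hc : Multiset.card M = Multiset.card M' + 2 := by rw [hMM]; simp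
    have key := ih (Multiset.card M' + 1) (by omega) ((m + 1) ::ₘ M') (by simp) (by omega) (by
      refine Nat.ModEq.trans ?_ hmod
      rw [hMM]
      simp only [Multiset.map_cons, Multiset.sum_cons]
      rw [← add_assoc]
      refine Nat.ModEq.add_right _ ?_
      by_cases h1 : h = 1
      · subst h1
        simpa using Nat.modEq_one
      have : Fact (1 < h) := ⟨by have := NeZero.pos h; omega⟩
      have := two_pow_add_mod h m 1
      rw [ZMod.val_one, pow_succ, mul_two] at this
      exact this.symm)
    have := congrArg Multiset.card key
    simp at this
    omega

def RSum {A : Type*} [AddCommGroup A] (T : Set A) (n : ℕ) (z : A) : Prop :=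
  ∃ s : ℕ → A, (∀ i < n, s i ∈ T) ∧ ∑ i ∈ Finset.range n, s i = z

lemma RSum.one {A : Type*} [AddCommGroup A] {T : Set A} {z : A} (hz : z ∈ T) : RSum T 1 z :=
  ⟨fun _ => z, by simpa using hz, by simp⟩

lemma RSum.add {A : Type*} [AddCommGroup A] {T : Set A} {n m : ℕ} {z w : A}
    (h1 : RSum T n z) (h2 : RSum T m w) : RSum T (n + m) (z + w) := by
  obtain ⟨s, hs, rfl⟩ := h1
  obtain ⟨r, hr, rfl⟩ := h2
  refine ⟨fun i => if i < n then s i else r (i - n), ?_, ?_⟩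
  · intro i hi
    dsimp only
    split_ifs with hc
    · exact hs i hc
    · exact hr _ (by omega)
  · rw [Finset.sum_range_add]
    congr 1
    · exact Finset.sum_congr rfl (fun i hi => by simp [Finset.mem_range.1 hi])
    · exact Finset.sum_congr rfl (fun i hi => by simp)

lemma RSum.seg {A : Type*} [AddCommGroup A] {T : Set A} {n : ℕ} {s : ℕ → A}
    (hs : ∀ i < n, s i ∈ T) {t u : ℕ} (htu : t ≤ u) (hu : u ≤ n) :
    RSum T (u - t) (∑ i ∈ Finset.range u, s i - ∑ i ∈ Finset.range t, s i) := by
  refine ⟨fun i => s (t + i), fun i hi => hs _ (by omega), ?_⟩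
  obtain ⟨d, rfl⟩ := Nat.exists_eq_add_of_le htu
  rw [Finset.sum_range_add]
  simp

/-- Two elements yield a short zero sum. -/
lemma short_zero_sum (h : ℕ) [NeZero h] (T : Set (ZMod h)) (x y : ZMod h) (hx : x ∈ T)
    (hy : y ∈ T) (hxy : x ≠ y) : ∃ n, 0 < n ∧ n < h ∧ RSum T n 0 := by
  have hsm : ∀ n : ℕ, RSum T n (n • x) := fun n => ⟨fun _ => x, fun _ _ => hx, by simp⟩
  by_cases hc : ∃ n, 0 < n ∧ n < h ∧ n • x = 0
  · obtain ⟨n, h1, h2, h3⟩ := hc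
    exact ⟨n, h1, h2, h3 ▸ hsm n⟩
  push Not at hc
  have hinj : Function.Injective (fun i : Fin h => (i : ℕ) • x) := by
    have aux : ∀ i j : Fin h, i < j → (i : ℕ) • x ≠ (j : ℕ) • x := by
      intro i j hij he
      refine hc (j - i) (by omega) (by omega) ?_
      rw [sub_nsmul _ hij.le, he]; simp
    intro i j he
    rcases lt_trichotomy i j with hl | hl | hl
    · exact (aux _ _ hl he).elim
    · exact hl
    · exact (aux _ _ hl he.symm).elim
  have hsurj := ((Fintype.bijective_iff_injective_and_card _).2 ⟨hinj, by simp [ZMod.card]⟩).2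
  obtain ⟨t, ht⟩ := hsurj y
  dsimp only at ht
  have ht1 : (t : ℕ) ≠ 1 := by
    intro h1; rw [h1] at ht; simp at ht; exact hxy ht
  by_cases ht0 : (t : ℕ) = 0
  · rw [ht0] at ht
    simp at ht
    refine ⟨1, by omega, ?_, ht ▸ RSum.one hy⟩
    by_contra hh
    have : h = 1 := by have := NeZero.pos h; omega
    subst this
    exact hxy (Subsingleton.elim _ _)
  · refine ⟨1 + (h - t), by omega, by omega, ?_⟩
    have := (RSum.one hy).add (hsm (h - t))
    rwa [← ht, sub_nsmul _ t.2.le, show h • x = 0 by simp, zero_add, add_neg_cancel] at this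

/-- minimal cycle -/
lemma min_cycle (h : ℕ) (T : Set (ZMod h)) (n : ℕ) (hn : 0 < n)
    (hT : RSum T n 0) (hmin : ∀ m, 0 < m → m < n → ¬ RSum T m 0) :
    ∃ p s : Fin n → ZMod h, Function.Injective p ∧ (∀ t, s t ∈ T) ∧
      (∀ u, ∃ t, p u = p t + s t) ∧ (∀ t u, ∀ z ∈ T, p u = p t + z → z = s t) := by
  obtain ⟨s, hs, h0⟩ := hT
  set P : ℕ → ZMod h := fun t => ∑ i ∈ Finset.range t, s i with hP
  have hPs : ∀ t, P (t + 1) = P t + s t := fun t => Finset.sum_range_succ _ _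
  have hP0 : P 0 = 0 := by simp [hP]
  have hPn : P n = 0 := h0
  have hseg : ∀ t u, t ≤ u → u ≤ n → RSum T (u - t) (P u - P t) := fun t u h1 h2 =>
    RSum.seg hs h1 h2
  refine ⟨fun t => P t, fun t => s t, ?_, fun t => hs t t.2, ?_, ?_⟩
  · have aux : ∀ i j : Fin n, i < j → P i ≠ P j := by
      intro i j hij he
      have := hseg i j (by omega) (by omega)
      rw [he, sub_self] at this
      exact hmin _ (by omega) (by omega) this
    intro i j he
    rcases lt_trichotomy i j with hl | hl | hl
    · exact (aux _ _ hl he).elim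
    · exact hl
    · exact (aux _ _ hl he.symm).elim
  · intro u
    rcases Nat.eq_zero_or_pos (u : ℕ) with hu | hu
    · refine ⟨⟨n - 1, by omega⟩, ?_⟩
      dsimp only
      rw [← hPs, hu, Nat.sub_add_cancel hn, hPn, hP0]
    · refine ⟨⟨u - 1, by omega⟩, ?_⟩
      dsimp only
      rw [← hPs, Nat.sub_add_cancel hu]
  · intro t u z hz he
    dsimp only at he
    by_cases htu : (t : ℕ) < u
    · have h1 := ((hseg 0 t (by omega) (by omega)).add (RSum.one hz)).add
        (hseg u n (by omega) (by omega))
      rw [hP0, hPn, he, show P t - 0 + z + (0 - (P t + z)) = 0 by ring] at h1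
      have : ¬ ((t : ℕ) - 0 + 1 + (n - u) < n) := fun hl => hmin _ (by omega) hl h1
      have : (u : ℕ) = t + 1 := by omega
      rw [this, hPs] at he
      exact (add_left_cancel he).symm
    · have h1 := (hseg u t (by omega) (by omega)).add (RSum.one hz)
      rw [he, show P t - (P t + z) + z = 0 by ring] at h1
      have : ¬ ((t : ℕ) - u + 1 < n) := fun hl => hmin _ (by omega) hl h1
      have hu : (u : ℕ) = 0 := by omega
      have ht : (t : ℕ) + 1 = n := by omega
      have h2 := hPs t
      rw [ht, hPn] at h2
      rw [hu, hP0] at he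
      exact add_left_cancel (he.symm.trans h2)

lemma core_sum (F : Type*) [Field F] [Fintype F] [DecidableEq F] [CharP F 2] (h : ℕ) [NeZero h]
    (hq : Fintype.card F = 2 ^ h) (a : ZMod h → F) (g : Fˣ → Fˣ) (hg : Function.Bijective g)
    (hga : ∀ x : Fˣ, (g x : F) * x = ∑ z, a z * (x : F) ^ (2 ^ z.val))
    (n : ℕ) (hn : 0 < n) (hnh : n < h) (p s : Fin n → ZMod h) (hp : Function.Injective p)
    (hs : ∀ t, a (s t) ≠ 0) (hps : ∀ u, ∃ t, p u = p t + s t)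
    (huniq : ∀ t u z, a z ≠ 0 → p u = p t + z → z = s t) : False := by
  classical
  set J : Finset (ZMod h) := Finset.univ.image p with hJdef
  have hJc : J.card = n := by rw [hJdef, Finset.card_image_of_injective _ hp]; simp
  have hJne : J.Nonempty := by rw [← Finset.card_pos]; omega
  have hJu : J ≠ Finset.univ := by
    intro hc; rw [hc] at hJc; simp [ZMod.card] at hJc; omega
  set k : ℕ := ∑ t, 2 ^ (p t).val with hk
  have hkJ : ∑ j ∈ J, 2 ^ j.val = k := by
    rw [hJdef, Finset.sum_image (fun _ _ _ _ hh => hp hh)]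
  have hklt : k < 2 ^ h - 1 := hkJ ▸ two_pow_sum_lt h J hJu
  have hkpos : 0 < k := by rw [← hkJ]; exact Finset.sum_pos (fun _ _ => by positivity) hJne
  obtain ⟨m, hm⟩ : ∃ m, 2 ^ h - 1 = m + 1 := ⟨2 ^ h - 2, by omega⟩
  have hpow1 : ∀ x : Fˣ, (x : F) * (x : F) ^ m = 1 := by
    intro x
    rw [← pow_succ', ← hm, ← hq]
    exact FiniteField.pow_card_sub_one_eq_one _ x.ne_zero
  have hsum0 : ∑ x : Fˣ, (g x : F) ^ k = 0 := by
    rw [hg.sum_comp (fun x : Fˣ => (x : F) ^ k)]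
    have := FiniteField.sum_pow_units F k
    rw [this, if_neg]
    rw [hq]
    intro hd
    exact absurd (Nat.le_of_dvd hkpos hd) (by omega)
  have hexp : ∀ x : Fˣ, (g x : F) ^ k = ∑ φ : Fin n → ZMod h,
      (∏ t, a (φ t) ^ (2 ^ (p t).val)) *
        (x : F) ^ ((∑ t, 2 ^ ((φ t).val + (p t).val)) + m * k) := by
    intro x
    have e1 : (g x : F) ^ k = ((g x : F) * x) ^ k * (x : F) ^ (m * k) := by
      rw [pow_mul, ← mul_pow, mul_assoc, hpow1, mul_one]
    rw [e1, hga, hk, ← Finset.prod_pow_eq_pow_sum]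
    have e2 : ∀ t, (∑ z, a z * (x : F) ^ (2 ^ z.val)) ^ (2 ^ (p t).val) =
        ∑ z, a z ^ (2 ^ (p t).val) * (x : F) ^ (2 ^ (z.val + (p t).val)) := by
      intro t
      rw [sum_pow_char_pow]
      refine Finset.sum_congr rfl fun z _ => ?_
      rw [mul_pow, ← pow_mul, ← pow_add]
    rw [Finset.prod_congr rfl (fun t _ => e2 t), Finset.prod_univ_sum, Finset.sum_mul,
      Fintype.piFinset_univ]
    refine Finset.sum_congr rfl fun φ _ => ?_
    rw [Finset.prod_mul_distrib, Finset.prod_pow_eq_pow_sum, mul_assoc, ← pow_add]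
  rw [Finset.sum_congr rfl (fun x _ => hexp x), Finset.sum_comm] at hsum0
  have hmk : (m + 1) * k ≡ 0 [MOD 2 ^ h - 1] := by
    rw [Nat.modEq_zero_iff_dvd, hm]; exact dvd_mul_right _ _
  have hmodk : ∀ E : ℕ, 2 ^ h - 1 ∣ E + m * k ↔ E ≡ k [MOD 2 ^ h - 1] := by
    intro E
    rw [← Nat.modEq_zero_iff_dvd]
    have hmk' : k + m * k ≡ 0 [MOD 2 ^ h - 1] := by
      have : (m + 1) * k = k + m * k := by ring
      rwa [this] at hmk
    constructor
    · intro hE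
      exact Nat.ModEq.add_right_cancel' _ (hE.trans hmk'.symm)
    · intro hE
      exact (hE.add_right _).trans hmk'
  have hinner : ∀ E : ℕ, ∑ x : Fˣ, (x : F) ^ (E + m * k) =
      if E ≡ k [MOD 2 ^ h - 1] then -1 else 0 := by
    intro E
    have := FiniteField.sum_pow_units F (E + m * k)
    rw [this, hq]
    simp only [hmodk]
  simp only [← Finset.mul_sum, hinner] at hsum0
  have hredmod : ∀ φ : Fin n → ZMod h, ∑ t, 2 ^ ((φ t).val + (p t).val) ≡
      ∑ t, 2 ^ (φ t + p t).val [MOD 2 ^ h - 1] := by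
    intro φ
    exact Nat.ModEq.sum (fun t _ => two_pow_add_mod h (φ t) (p t))
  rw [Finset.sum_eq_single s] at hsum0
  · rw [if_pos] at hsum0
    · rw [mul_neg, mul_one, neg_eq_zero, Finset.prod_eq_zero_iff] at hsum0
      obtain ⟨t, _, ht⟩ := hsum0
      exact pow_ne_zero _ (hs t) ht
    · refine (hredmod s).trans ?_
      choose v hv using hps
      have hvinj : Function.Injective v := by
        intro x y hxy
        apply hp
        rw [hv x, hv y, hxy]
      have : ∑ t, 2 ^ (s t + p t).val = k := by
        rw [hk, ← (Finite.injective_iff_bijective.1 hvinj).sum_comp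
          (fun t => 2 ^ (s t + p t).val)]
        refine Finset.sum_congr rfl fun t _ => ?_
        rw [hv t, add_comm]
      rw [this]
  · intro φ _ hφ
    by_cases hz : ∃ t, a (φ t) = 0
    · obtain ⟨t, ht⟩ := hz
      rw [Finset.prod_eq_zero (Finset.mem_univ t), zero_mul]
      rw [ht, zero_pow (by positivity)]
    push Not at hz
    rw [if_neg, mul_zero]
    intro hmod
    apply hφ
    have h1 := (hredmod φ).symm.trans hmod
    rw [← hkJ] at h1
    have h2 := binary_unique h J hJne hJu n (Finset.univ.val.map (fun t => φ t + p t))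
      (by simp) hJc.ge (by rw [Multiset.map_map]; exact h1)
    funext t
    have h3 : φ t + p t ∈ J := by
      rw [← Finset.mem_val, ← h2]
      exact Multiset.mem_map_of_mem _ (Finset.mem_univ_val t)
    obtain ⟨u, _, hu⟩ := Finset.mem_image.1 h3
    exact huniq t u _ (hz t) (by rw [hu, add_comm])
  · intro hc; exact absurd (Finset.mem_univ _) hc

/-- Every o-polynomial in which the degree of every term is a power of two is
in fact a monomial `x^(2^k)`. -/
theorem opoly_translation (F : Type*) [Field F] [Finite F] (h : ℕ) (hh : 0 < h)
    (hq : Nat.card F = 2 ^ h) (f : F[X]) (hf : IsOPoly F f)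
    (hpow : ∀ i : ℕ, f.coeff i ≠ 0 → ∃ j : ℕ, i = 2 ^ j) :
    ∃ k : ℕ, f = X ^ (2 ^ k) := by
  classical
  have : Fintype F := Fintype.ofFinite F
  have : NeZero h := ⟨hh.ne'⟩
  obtain ⟨hdeg, hbij, hf0, hf1, hdet⟩ := hf
  rw [Nat.card_eq_fintype_card] at hq hdeg
  have hchar : CharP F 2 := by
    obtain ⟨p, hp⟩ := CharP.exists F
    obtain ⟨e, hpp, hc⟩ := FiniteField.card F p
    have hd : p ∣ 2 ^ h := by
      rw [← hq, hc]; exact dvd_pow_self _ e.ne_zero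
    have h2 : p = 2 := (Nat.prime_dvd_prime_iff_eq hpp Nat.prime_two).1 (hpp.dvd_of_dvd_pow hd)
    rwa [h2] at hp
  set a : ZMod h → F := fun z => f.coeff (2 ^ z.val) with ha
  have hfa : f = ∑ z, C (a z) * X ^ (2 ^ z.val) := by
    ext i
    simp only [finsetSum_coeff, coeff_C_mul, coeff_X_pow]
    by_cases hi : f.coeff i = 0
    · rw [hi, Finset.sum_eq_zero]
      intro z _
      split_ifs with hz
      · simp only [ha, ← hz, hi, zero_mul]
      · simp
    · obtain ⟨j, rfl⟩ := hpow i hi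
      have h1 : 2 ^ j ≤ 2 ^ h - 1 := (le_natDegree_of_ne_zero hi).trans (hq ▸ hdeg)
      have hj : j < h := by
        have : 2 ^ j < 2 ^ h := by have := Nat.one_le_two_pow (n := h); omega
        exact (Nat.pow_lt_pow_iff_right (by norm_num)).1 this
      rw [Finset.sum_eq_single (j : ZMod h)]
      · simp [ha, ZMod.val_cast_of_lt hj]
      · intro z _ hz
        rw [if_neg, mul_zero]
        intro he
        have := Nat.pow_right_injective (le_refl 2) he
        apply hz
        rw [this]; simp
      · simp
  have hev : ∀ x : F, f.eval x = ∑ z, a z * x ^ (2 ^ z.val) := by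
    intro x
    conv_lhs => rw [hfa]
    simp [eval_finset_sum]
  have hne : ∀ x : Fˣ, f.eval (x : F) ≠ 0 := by
    intro x hx
    exact x.ne_zero (hbij.1 (hx.trans hf0.symm))
  set g : Fˣ → Fˣ := fun x => Units.mk0 (f.eval (x : F)) (hne x) * x⁻¹ with hg
  have hgx : ∀ x : Fˣ, (g x : F) * x = f.eval (x : F) := by
    intro x; simp [hg]
  have hginj : Function.Injective g := by
    intro x y hxy
    by_contra hxy'
    refine hdet 0 x y x.ne_zero.symm y.ne_zero.symm (fun hc => hxy' (Units.ext hc)) ?_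
    rw [Matrix.det_fin_three]
    simp [hf0, ← hgx, hxy]
    ring
  have hTsub : ∀ x y, a x ≠ 0 → a y ≠ 0 → x = y := by
    intro x y hx hy
    by_contra hxy
    have hex := short_zero_sum h {z | a z ≠ 0} x y hx hy hxy
    have hspec := Nat.find_spec hex
    have hmn : ∀ m < Nat.find hex, ¬ _ := fun m hm => Nat.find_min hex hm
    generalize Nat.find hex = n at hspec hmn
    obtain ⟨hn, hnh, hR⟩ := hspec
    obtain ⟨p, s, hp, hs, hps, huq⟩ := min_cycle h {z | a z ≠ 0} n hn hR
      (fun m h0 hm hc => hmn m hm ⟨h0, hm.trans hnh, hc⟩)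
    exact core_sum F h hq a g (Finite.injective_iff_bijective.1 hginj)
      (fun x => (hgx x).trans (hev x)) n hn hnh p s hp hs hps
      (fun t u z hz he => huq t u z hz he)
  obtain ⟨z0, hz0⟩ : ∃ z, a z ≠ 0 := by
    by_contra hc
    push Not at hc
    rw [hev] at hf1
    simp [hc] at hf1
  have hzero : ∀ z, z ≠ z0 → a z = 0 := by
    intro z hz
    by_contra hc
    exact hz (hTsub z z0 hc hz0)
  have h1 : a z0 = 1 := by
    rw [hev, Finset.sum_eq_single z0 (fun z _ hz => by rw [hzero z hz, zero_mul])
      (by simp)] at hf1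
    simpa using hf1
  refine ⟨z0.val, ?_⟩
  rw [hfa, Finset.sum_eq_single z0 (fun z _ hz => by rw [hzero z hz]; simp) (by simp), h1]
  simp
end
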